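/- For any γ > −1, the operator f ↦ I₀^♯( μ^{−2γ−1} I₀( d^γ f ) ) maps C^∞(𝔻) into C^∞(𝔻) and is a linear bijection of C^∞(𝔻) onto itself. -/

import Mathlib

open MeasureTheory Complex Metric Real Set

noncomputable section

/-! ## Geometry of the Euclidean disk and its space of lines (fan-beam coordinates) -/

/-- The chord of the closed unit disk through the boundary point `exp (I β)` with incoming
direction `exp (I (β + π + α))`, parametrized by arclength `t ∈ [0, 2 cos α]`. -/
def chord (β α t : ℝ) : ℂ :=
  Complex.exp ((β : ℂ) * Complex.I) +
    (t : ℂ) * Complex.exp (((β + π + α : ℝ) : ℂ) * Complex.I)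

/-- The X-ray transform `I₀` in fan-beam coordinates. -/
def XRT (f : ℂ → ℂ) (β α : ℝ) : ℂ :=
  ∫ t in (0:ℝ)..(2 * Real.cos α), f (chord β α t)

/-- The fan-beam coordinate `α₋(z, θ)` of the unique chord through `z` with direction `exp (I θ)`,
determined by `sin α₋ = Im (z * exp (-I θ))`. -/
def alpham (z : ℂ) (θ : ℝ) : ℝ :=
  Real.arcsin ((z * Complex.exp (-(θ : ℂ) * Complex.I)).im)

/-- The fan-beam coordinate `β₋(z, θ)`, determined by `β₋ + α₋ + π = θ`. -/
def betam (z : ℂ) (θ : ℝ) : ℝ := θ - π - alpham z θ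

/-- Reduction modulo `2π` to the fundamental interval `(0, 2π]`. -/
def wrap (x : ℝ) : ℝ := toIocMod Real.two_pi_pos 0 x

/-- The backprojection operator `I₀^♯`. -/
def BP (g : ℝ × ℝ → ℂ) (z : ℂ) : ℂ :=
  ∫ θ in (0:ℝ)..(2 * π), g (wrap (betam z θ), alpham z θ)

/-- The weighted backprojection operator `I₀^♯ μ^{-2γ-1}`, where `μ(β, α) = cos α`. -/
def BPW (γ : ℝ) (g : ℝ × ℝ → ℂ) : ℂ → ℂ :=
  BP fun p => ((Real.cos p.2 ^ (-(2 * γ) - 1) : ℝ) : ℂ) * g p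

/-- The rectangle `(0, 2π] × [-π/2, π/2]` modelling the space of lines `∂₊S𝔻`. -/
def Rect : Set (ℝ × ℝ) := Set.Ioc (0:ℝ) (2 * π) ×ˢ Set.Icc (-(π / 2)) (π / 2)

/-- The measure `μ^{-2γ} dβ dα` on `∂₊S𝔻`, where `μ(β, α) = cos α`. -/
def bdryMeasure (γ : ℝ) : Measure (ℝ × ℝ) :=
  ((volume : Measure (ℝ × ℝ)).restrict Rect).withDensity
    fun p => ENNReal.ofReal (Real.cos p.2 ^ (-(2 * γ)))

/-- The measure `d^γ dz` on the closed unit disk, where `d(z) = 1 - |z|²`. -/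
def diskMeasure (γ : ℝ) : Measure ℂ :=
  ((volume : Measure ℂ).restrict (Metric.closedBall 0 1)).withDensity
    fun z => ENNReal.ofReal ((1 - ‖z‖ ^ 2) ^ γ)

/-- `L n` is the monic orthogonal polynomial of degree `n` on `[-1, 1]` for the weight
`(1 - x²)^(γ + 1/2)`. -/
def IsMonicOrtho (γ : ℝ) (L : ℕ → Polynomial ℝ) : Prop :=
  ∀ n, (L n).Monic ∧ (L n).natDegree = n ∧
    ∀ m, m < n →
      (∫ x in (-1:ℝ)..(1:ℝ), (L n).eval x * x ^ m * (1 - x ^ 2) ^ (γ + 1/2)) = 0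

/-- The functions `ψ_{n,k}^γ = μ^{2γ+1} ((-1)^n / 2π) e^{i(n-2k)(β+α)} L_n^γ (sin α)`. -/
def psiF (γ : ℝ) (L : ℕ → Polynomial ℝ) (n : ℕ) (k : ℤ) (p : ℝ × ℝ) : ℂ :=
  ((Real.cos p.2 ^ (2 * γ + 1) : ℝ) : ℂ) * (((-1 : ℝ) ^ n / (2 * π) : ℝ) : ℂ) *
    Complex.exp (Complex.I * ((n : ℂ) - 2 * (k : ℂ)) * ((p.1 + p.2 : ℝ) : ℂ)) *
    (((L n).eval (Real.sin p.2) : ℝ) : ℂ)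

/-- The generalized Zernike polynomials
`G_{n,k}^γ (z) = (1/2π) ∫₀^{2π} e^{i(n-2k)θ} L_n^γ ((i/2)(z̄ e^{iθ} - z e^{-iθ})) dθ`. -/
def GZ (γ : ℝ) (L : ℕ → Polynomial ℝ) (n : ℕ) (k : ℤ) (z : ℂ) : ℂ :=
  ((1 / (2 * π) : ℝ) : ℂ) * ∫ θ in (0:ℝ)..(2 * π),
    Complex.exp (Complex.I * ((n : ℂ) - 2 * (k : ℂ)) * (θ : ℂ)) *
      Polynomial.aeval
        ((Complex.I / 2) *
          ((starRingEnd ℂ) z * Complex.exp ((θ : ℂ) * Complex.I) -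
            z * Complex.exp (-(θ : ℂ) * Complex.I))) (L n)

/-- `L²(𝔻, d^γ dz)`-norm. -/
def dNorm (γ : ℝ) (f : ℂ → ℂ) : ℝ := Real.sqrt (∫ z, ‖f z‖ ^ 2 ∂(diskMeasure γ))

/-- `L²(∂₊S𝔻, μ^{-2γ} dβ dα)`-norm. -/
def bNorm (γ : ℝ) (g : ℝ × ℝ → ℂ) : ℝ := Real.sqrt (∫ p, ‖g p‖ ^ 2 ∂(bdryMeasure γ))

/-- `G_{n,k}^γ` normalized to unit norm in `L²(𝔻, d^γ dz)`. -/
def Ghat (γ : ℝ) (L : ℕ → Polynomial ℝ) (n : ℕ) (k : ℤ) (z : ℂ) : ℂ :=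
  (((dNorm γ (GZ γ L n k))⁻¹ : ℝ) : ℂ) * GZ γ L n k z

/-- `ψ_{n,k}^γ` normalized to unit norm in `L²(∂₊S𝔻, μ^{-2γ} dβ dα)`. -/
def psihat (γ : ℝ) (L : ℕ → Polynomial ℝ) (n : ℕ) (k : ℤ) (p : ℝ × ℝ) : ℂ :=
  (((bNorm γ (psiF γ L n k))⁻¹ : ℝ) : ℂ) * psiF γ L n k p

/-- The squared singular values `(σ_{n,k}^γ)²`. -/
def sigSq (γ : ℝ) (n k : ℕ) : ℝ :=
  2 ^ (2 * γ + 2) * π * (n.choose k) *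
    Real.Gamma ((n : ℝ) - k + γ + 1) * Real.Gamma ((k : ℝ) + γ + 1) /
      Real.Gamma ((n : ℝ) + 2 * γ + 2)

/-- The singular values `σ_{n,k}^γ ≥ 0`. -/
def sig (γ : ℝ) (n k : ℕ) : ℝ := Real.sqrt (sigSq γ n k)

/-- The Beta function `B(x,y) = Γ(x)Γ(y)/Γ(x+y)`. -/
def betaFn (x y : ℝ) : ℝ := Real.Gamma x * Real.Gamma y / Real.Gamma (x + y)

/-! ## Differential operators -/

/-- Radial derivative `∂_ρ` in polar coordinates `z = ρ e^{iω}`. -/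
def dRho (f : ℂ → ℂ) (z : ℂ) : ℂ :=
  deriv (fun r : ℝ => f ((r : ℂ) * Complex.exp ((z.arg : ℂ) * Complex.I))) ‖z‖

/-- Angular derivative `∂_ω` in polar coordinates `z = ρ e^{iω}`. -/
def dOmega (f : ℂ → ℂ) (z : ℂ) : ℂ :=
  deriv (fun w : ℝ => f ((‖z‖ : ℂ) * Complex.exp ((w : ℂ) * Complex.I))) z.arg

/-- The operator `𝓛_γ = -(1-ρ²)∂_ρ² - (ρ⁻¹ - (3+2γ)ρ)∂_ρ - ρ⁻²∂_ω² + (γ+1)²`. -/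
def Lop (γ : ℝ) (f : ℂ → ℂ) (z : ℂ) : ℂ :=
  -(1 - (‖z‖ : ℂ) ^ 2) * dRho (dRho f) z -
    ((‖z‖ : ℂ)⁻¹ - (3 + 2 * (γ : ℂ)) * (‖z‖ : ℂ)) * dRho f z -
    ((‖z‖ : ℂ) ^ 2)⁻¹ * dOmega (dOmega f) z + ((γ : ℂ) + 1) ^ 2 * f z

/-- `∂_β` on `∂₊S𝔻`. -/
def dBeta (g : ℝ × ℝ → ℂ) (p : ℝ × ℝ) : ℂ := deriv (fun b : ℝ => g (b, p.2)) p.1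

/-- `∂_α` on `∂₊S𝔻`. -/
def dAlpha (g : ℝ × ℝ → ℂ) (p : ℝ × ℝ) : ℂ := deriv (fun a : ℝ => g (p.1, a)) p.2

/-- The operator `T = ∂_β - ∂_α`. -/
def Tline (g : ℝ × ℝ → ℂ) (p : ℝ × ℝ) : ℂ := dBeta g p - dAlpha g p

/-- The power `μ^e = (cos α)^e` as a complex-valued function on `∂₊S𝔻`. -/
def muC (e : ℝ) (p : ℝ × ℝ) : ℂ := ((Real.cos p.2 ^ e : ℝ) : ℂ)

/-- The operator `𝓣_γ = -μ^{2γ} T μ^{-2γ} T + γ²`. -/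
def Tgam (γ : ℝ) (g : ℝ × ℝ → ℂ) (p : ℝ × ℝ) : ℂ :=
  -muC (2 * γ) p * Tline (fun q => muC (-(2 * γ)) q * Tline g q) p + (γ : ℂ) ^ 2 * g p

/-! ## Scattering relations and the space `C^∞_{α,+,+}(∂₊S𝔻)` -/

/-- The scattering relation `𝒮(β, α) = (β + π + 2α, π - α)`. -/
def Scat (p : ℝ × ℝ) : ℝ × ℝ := (p.1 + π + 2 * p.2, π - p.2)

/-- The antipodal scattering relation `𝒮_A(β, α) = (β + π + 2α, -α)`. -/
def ScatA (p : ℝ × ℝ) : ℝ × ℝ := (p.1 + π + 2 * p.2, -p.2)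

/-- Membership in `C^∞_{α,+,+}(∂₊S𝔻)`: `f`, given on the strip `ℝ × [-π/2, π/2]` (2π-periodically
in β), has an even extension through the scattering relation which is smooth on all of `∂S𝔻`
(modelled as a doubly 2π-periodic smooth function on `ℝ²` invariant under `𝒮`), and `f` is
invariant under the antipodal scattering relation. -/
def MemCapp (f : ℝ × ℝ → ℂ) : Prop :=
  ∃ F : ℝ × ℝ → ℂ, ContDiff ℝ (⊤ : ℕ∞) F ∧
    (∀ p : ℝ × ℝ, F (p.1 + 2 * π, p.2) = F p) ∧
    (∀ p : ℝ × ℝ, F (p.1, p.2 + 2 * π) = F p) ∧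
    (∀ p : ℝ × ℝ, F (Scat p) = F p) ∧
    (∀ p : ℝ × ℝ, p.2 ∈ Set.Icc (-(π / 2)) (π / 2) → F (ScatA p) = F p) ∧
    (∀ p : ℝ × ℝ, p.2 ∈ Set.Icc (-(π / 2)) (π / 2) → f p = F p)

/-- `C^∞(𝔻)`: smooth up to the boundary of the closed unit disk. -/
def CinfDisk (f : ℂ → ℂ) : Prop := ContDiffOn ℝ (⊤ : ℕ∞) f (Metric.closedBall 0 1)

end

noncomputable section

/-- The normal operator `N_γ = I₀^♯ μ^{-2γ-1} I₀ d^γ`. -/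
def Nop (γ : ℝ) (f : ℂ → ℂ) : ℂ → ℂ :=
  BPW γ (fun p => XRT (fun w => (((1 - ‖w‖ ^ 2) ^ γ : ℝ) : ℂ) * f w) p.1 p.2)

/-! ## Polynomials in `z` and `z̄` -/

/-- The monomial `z ^ a * z̄ ^ b`. -/
def zmono (a b : ℕ) (z : ℂ) : ℂ := z ^ a * (starRingEnd ℂ z) ^ b

/-- Polynomials in `z` and `z̄` of total degree less than `n`, as functions on `ℂ`. -/
def zPoly (n : ℕ) : Submodule ℂ (ℂ → ℂ) :=
  Submodule.span ℂ {f | ∃ a b, a + b < n ∧ f = zmono a b}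

lemma zmono_mem_zPoly {a b n : ℕ} (h : a + b < n) : zmono a b ∈ zPoly n :=
  Submodule.subset_span ⟨a, b, h, rfl⟩

lemma zPoly_mono {m n : ℕ} (h : m ≤ n) : zPoly m ≤ zPoly n :=
  Submodule.span_mono fun _ ⟨a, b, hab, hf⟩ => ⟨a, b, hab.trans_le h, hf⟩

lemma zPoly_zero_eq_zero {p : ℂ → ℂ} (hp : p ∈ zPoly 0) : p = 0 := by
  have : {f : ℂ → ℂ | ∃ a b, a + b < 0 ∧ f = zmono a b} = ∅ := by
    ext; simp
  simpa [zPoly, this] using hp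

instance finiteDimensional_zPoly (n : ℕ) : FiniteDimensional ℂ (zPoly n) := by
  apply FiniteDimensional.span_of_finite
  apply ((Finset.range n ×ˢ Finset.range n).finite_toSet.image
    fun q : ℕ × ℕ => zmono q.1 q.2).subset
  rintro _ ⟨a, b, hab, rfl⟩
  exact ⟨(a, b), by simp; omega, rfl⟩

lemma mul_mem_zPoly {n m : ℕ} {p q : ℂ → ℂ} (hp : p ∈ zPoly (n + 1)) (hq : q ∈ zPoly (m + 1)) :
    p * q ∈ zPoly (n + m + 1) := by
  induction hp using Submodule.span_induction with
  | mem p hp =>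
    obtain ⟨a, b, hab, rfl⟩ := hp
    induction hq using Submodule.span_induction with
    | mem q hq =>
      obtain ⟨c, d, hcd, rfl⟩ := hq
      have : zmono a b * zmono c d = zmono (a + c) (b + d) := by
        ext z; simp only [Pi.mul_apply, zmono]; ring
      rw [this]
      exact zmono_mem_zPoly (by omega)
    | zero => simp
    | add x y _ _ hx hy => rw [mul_add]; exact add_mem hx hy
    | smul c x _ hx => rw [mul_smul_comm]; exact Submodule.smul_mem _ _ hx
  | zero => simp
  | add x y _ _ hx hy => rw [add_mul]; exact add_mem hx hy
  | smul c x _ hx => rw [smul_mul_assoc]; exact Submodule.smul_mem _ _ hx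

lemma star_mem_zPoly {n : ℕ} {p : ℂ → ℂ} (hp : p ∈ zPoly n) : star p ∈ zPoly n := by
  induction hp using Submodule.span_induction with
  | mem p hp =>
    obtain ⟨a, b, hab, rfl⟩ := hp
    have : star (zmono a b) = zmono b a := by
      ext z; simp [zmono, mul_comm]
    rw [this]
    exact zmono_mem_zPoly (by omega)
  | zero => simp
  | add x y _ _ hx hy => rw [star_add]; exact add_mem hx hy
  | smul c x _ hx => rw [star_smul]; exact Submodule.smul_mem _ _ hx

/-- The real-linear map `h ↦ u h + w h̄`. -/
def wirt (u w : ℂ) : ℂ →L[ℝ] ℂ :=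
  u • ContinuousLinearMap.id ℝ ℂ + w • (Complex.conjCLE : ℂ →L[ℝ] ℂ)

@[simp] lemma wirt_apply (u w h : ℂ) : wirt u w h = u * h + w * starRingEnd ℂ h := by
  simp [wirt]

lemma hasFDerivAt_zmono (a b : ℕ) (z : ℂ) :
    HasFDerivAt (zmono a b) (wirt (a * zmono (a - 1) b z) (b * zmono a (b - 1) z)) z := by
  have h1 : HasFDerivAt (fun z : ℂ => z ^ a) ((a * z ^ (a - 1)) • ContinuousLinearMap.id ℝ ℂ) z := by
    have := ((hasDerivAt_pow a z).hasFDerivAt).restrictScalars ℝ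
    convert! this using 1
    ext <;> simp [mul_comm]
  have h2 : HasFDerivAt (fun z : ℂ => (starRingEnd ℂ z) ^ b)
      ((b * (starRingEnd ℂ z) ^ (b - 1)) • (Complex.conjCLE : ℂ →L[ℝ] ℂ)) z := by
    have h3 : HasFDerivAt (fun z : ℂ => starRingEnd ℂ z) (Complex.conjCLE : ℂ →L[ℝ] ℂ) z :=
      Complex.conjCLE.hasFDerivAt
    have := (((hasDerivAt_pow b (starRingEnd ℂ z)).hasFDerivAt).restrictScalars ℝ).comp z h3
    convert! this using 1
    ext <;> simp [mul_comm]
  have := h1.mul h2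
  convert! this using 1
  apply ContinuousLinearMap.ext
  intro h
  simp [zmono]
  ring

lemma exists_hasFDerivAt_of_mem_zPoly {n : ℕ} {p : ℂ → ℂ} (hp : p ∈ zPoly n) :
    ∃ pz ∈ zPoly n, ∃ pw ∈ zPoly n, ∀ z, HasFDerivAt p (wirt (pz z) (pw z)) z := by
  induction hp using Submodule.span_induction with
  | mem p hp =>
    obtain ⟨a, b, hab, rfl⟩ := hp
    exact ⟨(a : ℂ) • zmono (a - 1) b, Submodule.smul_mem _ _ (zmono_mem_zPoly (by omega)),
      (b : ℂ) • zmono a (b - 1), Submodule.smul_mem _ _ (zmono_mem_zPoly (by omega)),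
      fun z => hasFDerivAt_zmono a b z⟩
  | zero =>
    refine ⟨0, zero_mem _, 0, zero_mem _, fun z => ?_⟩
    have h0 : wirt ((0 : ℂ → ℂ) z) ((0 : ℂ → ℂ) z) = 0 := by
      apply ContinuousLinearMap.ext
      intro h
      simp
    rw [h0]
    exact hasFDerivAt_const (0 : ℂ) z
  | add x y _ _ hx hy =>
    obtain ⟨pz, hpz, pw, hpw, h⟩ := hx
    obtain ⟨qz, hqz, qw, hqw, h'⟩ := hy
    refine ⟨pz + qz, add_mem hpz hqz, pw + qw, add_mem hpw hqw, fun z => ?_⟩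
    convert! (h z).add (h' z) using 1
    apply ContinuousLinearMap.ext
    intro h
    simp
    ring
  | smul c x _ hx =>
    obtain ⟨pz, hpz, pw, hpw, h⟩ := hx
    refine ⟨c • pz, Submodule.smul_mem _ _ hpz, c • pw, Submodule.smul_mem _ _ hpw, fun z => ?_⟩
    convert! (h z).const_smul c using 1
    apply ContinuousLinearMap.ext
    intro h
    simp
    ring

lemma continuous_of_mem_zPoly {n : ℕ} {p : ℂ → ℂ} (hp : p ∈ zPoly n) : Continuous p := by
  obtain ⟨pz, -, pw, -, h⟩ := exists_hasFDerivAt_of_mem_zPoly hp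
  exact continuous_iff_continuousAt.2 fun z => (h z).continuousAt

lemma contDiff_zmono (a b : ℕ) : ContDiff ℝ (⊤ : ℕ∞) (zmono a b) := by
  have h3 : ContDiff ℝ (⊤ : ℕ∞) (fun z : ℂ => starRingEnd ℂ z) := Complex.conjCLE.contDiff
  exact (contDiff_id.pow a).mul (h3.pow b)

/-- Restriction of a polynomial in `z`, `z̄` to a line. -/
lemma exists_polynomial_line {n : ℕ} {p : ℂ → ℂ} (hp : p ∈ zPoly n) (z v : ℂ) :
    ∃ q : Polynomial ℂ, q.degree < n ∧ ∀ t : ℝ, p (z + t * v) = q.eval (t : ℂ) := by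
  induction hp using Submodule.span_induction with
  | mem p hp =>
    obtain ⟨a, b, hab, rfl⟩ := hp
    refine ⟨(Polynomial.C v * Polynomial.X + Polynomial.C z) ^ a *
      (Polynomial.C (starRingEnd ℂ v) * Polynomial.X + Polynomial.C (starRingEnd ℂ z)) ^ b, ?_, ?_⟩
    · have h1 : ∀ (c d : ℂ) (k : ℕ),
          ((Polynomial.C c * Polynomial.X + Polynomial.C d) ^ k).degree ≤ (k : WithBot ℕ) := by
        intro c d k
        refine (Polynomial.degree_pow_le _ k).trans ?_
        calc k • (Polynomial.C c * Polynomial.X + Polynomial.C d).degree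
            ≤ k • (1 : WithBot ℕ) := nsmul_le_nsmul_right Polynomial.degree_linear_le k
          _ = k := by simp
      refine lt_of_le_of_lt ((Polynomial.degree_mul_le _ _).trans
        (add_le_add (h1 _ _ _) (h1 _ _ _))) ?_
      exact_mod_cast hab
    · intro t
      simp [zmono]
      ring
  | zero => exact ⟨0, by simp, by simp⟩
  | add x y _ _ hx hy =>
    obtain ⟨q, hq, h⟩ := hx
    obtain ⟨r, hr, h'⟩ := hy
    exact ⟨q + r, (Polynomial.degree_add_le _ _).trans_lt (max_lt hq hr), fun t => by simp [h, h']⟩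
  | smul c x _ hx =>
    obtain ⟨q, hq, h⟩ := hx
    exact ⟨c • q, (Polynomial.degree_smul_le _ _).trans_lt hq, fun t => by simp [h]⟩

/-- A polynomial in `z`, `z̄` vanishing on the disk vanishes. -/
lemma eq_zero_of_eqOn_closedBall {n : ℕ} {p : ℂ → ℂ} (hp : p ∈ zPoly n)
    (h : ∀ z ∈ closedBall (0 : ℂ) 1, p z = 0) : p = 0 := by
  ext z
  obtain ⟨q, -, hq⟩ := exists_polynomial_line hp 0 z
  have hq0 : q = 0 := by
    apply Polynomial.eq_zero_of_infinite_isRoot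
    have hinf : (Set.Ioo (0 : ℝ) (1 / (‖z‖ + 1))).Infinite := Set.Ioo_infinite (by positivity)
    refine (hinf.image (f := fun t : ℝ => (t : ℂ)) Complex.ofReal_injective.injOn).mono ?_
    rintro _ ⟨t, ht, rfl⟩
    simp only [Polynomial.IsRoot, mem_ofPred_eq]
    rw [← hq]
    apply h
    have h1 : t * (‖z‖ + 1) < 1 := by
      have := ht.2
      rwa [lt_div_iff₀ (by positivity)] at this
    simp [abs_of_pos ht.1]
    nlinarith [ht.1, norm_nonneg z]
  have := hq 1
  simpa [hq0] using this

/-! ## Markov's inequality -/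

lemma abs_derivative_eval_one_le {n : ℕ} {P : Polynomial ℝ} {M : ℝ} (hP : P.degree ≤ n)
    (hM : ∀ x ∈ Set.Icc (-1 : ℝ) 1, |P.eval x| ≤ M) :
    |P.derivative.eval 1| ≤ n ^ 2 * M := by
  have key : ∀ (Q : Polynomial ℝ) (N : ℝ), 0 < N → Q.degree ≤ n →
      (∀ x ∈ Set.Icc (-1 : ℝ) 1, |Q.eval x| ≤ N) → Q.derivative.eval 1 ≤ n ^ 2 * N := by
    intro Q N hN hQ hb
    have := Polynomial.Chebyshev.eval_iterate_derivative_le_of_forall_abs_le_one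
      (n := n) (P := N⁻¹ • Q) (k := 1) (x := 1) le_rfl
      ((Polynomial.degree_smul_le _ _).trans hQ) (fun x hx => by
        simp only [Polynomial.eval_smul, smul_eq_mul, abs_mul, abs_inv, abs_of_pos hN]
        rw [inv_mul_le_iff₀ hN]; simpa using hb x hx)
    simp only [Function.iterate_one, Polynomial.derivative_smul, Polynomial.eval_smul,
      smul_eq_mul, Polynomial.Chebyshev.derivative_T_eval_one] at this
    rw [inv_mul_le_iff₀ hN] at this
    simpa [mul_comm] using this
  have hM0 : 0 ≤ M := (abs_nonneg _).trans (hM 1 (by simp))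
  apply le_of_forall_pos_le_add
  intro ε hε
  have hn : (0 : ℝ) < n ^ 2 + 1 := by positivity
  have hN : 0 < M + ε / (n ^ 2 + 1) := by positivity
  have hle : n ^ 2 * (M + ε / (n ^ 2 + 1)) ≤ n ^ 2 * M + ε := by
    have : n ^ 2 * (ε / (n ^ 2 + 1)) ≤ ε := by
      rw [mul_div_assoc', div_le_iff₀ hn]; nlinarith
    linarith
  have hb : ∀ x ∈ Set.Icc (-1 : ℝ) 1, |P.eval x| ≤ M + ε / (n ^ 2 + 1) := fun x hx =>
    (hM x hx).trans (by have : 0 ≤ ε / (n ^ 2 + 1) := by positivity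
                        linarith)
  rw [abs_le]
  constructor
  · have := key (-P) _ hN (by simpa using hP) (fun x hx => by simpa using hb x hx)
    simp only [Polynomial.derivative_neg, Polynomial.eval_neg] at this
    linarith
  · exact (key P _ hN hP hb).trans hle

lemma norm_derivative_eval_zero_le {n : ℕ} {q : Polynomial ℂ} {M : ℝ} (hq : q.degree < n)
    (hM : ∀ t ∈ Set.Icc (0 : ℝ) 1, ‖q.eval (t : ℂ)‖ ≤ M) :
    ‖q.derivative.eval 0‖ ≤ 4 * n ^ 2 * M := by
  have hnat : q = 0 ∨ q.natDegree < n := by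
    by_cases h : q = 0
    · exact Or.inl h
    · exact Or.inr ((Polynomial.natDegree_lt_iff_degree_lt h).2 hq)
  have hM0 : 0 ≤ M := (norm_nonneg _).trans (hM 0 (by simp))
  rcases hnat with rfl | hnat
  · simp; positivity
  have part : ∀ (φ : ℂ →ₗ[ℝ] ℝ), (∀ z, |φ z| ≤ ‖z‖) → |φ (q.derivative.eval 0)| ≤ 2 * n ^ 2 * M := by
    intro φ hφ
    let A : Polynomial ℝ := ∑ i ∈ Finset.range n, Polynomial.C (φ (q.coeff i)) * Polynomial.X ^ i
    have hA : ∀ t : ℝ, A.eval t = φ (q.eval (t : ℂ)) := by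
      intro t
      rw [Polynomial.eval_eq_sum_range' hnat, map_sum, Polynomial.eval_finsetSum]
      refine Finset.sum_congr rfl fun i _ => ?_
      have : q.coeff i * (t : ℂ) ^ i = (t ^ i : ℝ) • q.coeff i := by
        rw [Complex.real_smul]; push_cast; ring
      rw [this, map_smul, Polynomial.eval_mul, Polynomial.eval_C, Polynomial.eval_pow,
        Polynomial.eval_X, smul_eq_mul, mul_comm]
    have hAd : A.derivative.eval 0 = φ (q.derivative.eval 0) := by
      have h1 : A.coeff 1 = φ (q.coeff 1) := by
        simp only [A, Polynomial.finsetSum_coeff, Polynomial.coeff_C_mul, Polynomial.coeff_X_pow]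
        by_cases hn : 1 < n
        · simp [hn]
        · have : q.coeff 1 = 0 := Polynomial.coeff_eq_zero_of_natDegree_lt (by omega)
          simp [this]
      rw [← Polynomial.coeff_zero_eq_eval_zero, ← Polynomial.coeff_zero_eq_eval_zero,
        Polynomial.coeff_derivative, Polynomial.coeff_derivative]
      simp [h1]
    have hdeg : A.degree ≤ n := by
      refine (Polynomial.degree_sum_le _ _).trans (Finset.sup_le fun i hi => ?_)
      refine (Polynomial.degree_C_mul_X_pow_le _ _).trans ?_
      exact_mod_cast (Finset.mem_range.1 hi).le
    -- Precompose with the affine map sending `1` to `0` and `-1` to `1`.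
    let ℓ : Polynomial ℝ := Polynomial.C (-(1 / 2)) * Polynomial.X + Polynomial.C (1 / 2)
    have hB := abs_derivative_eval_one_le (n := n) (P := A.comp ℓ) (M := M) (by
        have h1 : (A.comp ℓ).natDegree ≤ n := by
          refine Polynomial.natDegree_comp_le.trans ?_
          have h2 : ℓ.natDegree ≤ 1 := Polynomial.natDegree_linear_le
          have h3 : A.natDegree ≤ n := Polynomial.natDegree_le_of_degree_le hdeg
          calc _ ≤ n * 1 := Nat.mul_le_mul h3 h2
            _ = n := mul_one n
        exact Polynomial.degree_le_of_natDegree_le h1)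
      (fun x hx => by
        rw [Polynomial.eval_comp, hA]
        refine (hφ _).trans (hM _ ?_)
        simp only [ℓ, Polynomial.eval_add, Polynomial.eval_mul, Polynomial.eval_C,
          Polynomial.eval_X]
        constructor <;> linarith [hx.1, hx.2])
    have h4 : ((A.comp ℓ).derivative).eval 1 = -(1 / 2) * A.derivative.eval 0 := by
      simp [Polynomial.derivative_comp, ℓ]
    rw [h4, abs_mul, hAd] at hB
    norm_num at hB
    linarith
  have hre := part Complex.reLm Complex.abs_re_le_norm
  have him := part Complex.imLm Complex.abs_im_le_norm
  have := Complex.norm_le_abs_re_add_abs_im (q.derivative.eval 0)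
  simp only [Complex.reLm_coe, Complex.imLm_coe] at hre him
  linarith

lemma norm_fderiv_apply_le_of_segment {n : ℕ} {p : ℂ → ℂ} (hp : p ∈ zPoly n) {M : ℝ}
    {z v : ℂ} {D : ℂ →L[ℝ] ℂ} (hD : HasFDerivAt p D z)
    (hM : ∀ t ∈ Set.Icc (0 : ℝ) 1, ‖p (z + t * v)‖ ≤ M) : ‖D v‖ ≤ 4 * n ^ 2 * M := by
  obtain ⟨q, hq, h⟩ := exists_polynomial_line hp z v
  have h1 := norm_derivative_eval_zero_le hq (fun t ht => (h t) ▸ hM t ht)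
  have h2 : HasDerivAt (fun t : ℝ => p (z + t * v)) (D v) 0 := by
    have hl : HasDerivAt (fun t : ℝ => z + (t : ℂ) * v) v 0 := by
      simpa using ((Complex.ofRealCLM.hasDerivAt (x := (0 : ℝ))).mul_const v).const_add z
    have hD' : HasFDerivAt p D ((fun t : ℝ => z + (t : ℂ) * v) 0) := by simpa using hD
    exact hD'.comp_hasDerivAt (0 : ℝ) hl
  have h3 : HasDerivAt (fun t : ℝ => p (z + t * v)) (q.derivative.eval 0) 0 := by
    have := (q.hasDerivAt ((0 : ℝ) : ℂ)).comp_ofReal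
    simp only [h]
    simpa using this
  rw [h2.unique h3]
  exact h1

/-- Through every point of the disk there are two orthogonal unit segments in the disk. -/
lemma exists_unit_segments {z : ℂ} (hz : ‖z‖ ≤ 1) : ∃ v : ℂ, ‖v‖ = 1 ∧
    ∀ t ∈ Set.Icc (0 : ℝ) 1, ‖z + t * v‖ ≤ 1 ∧ ‖z + t * (Complex.I * v)‖ ≤ 1 := by
  obtain ⟨e, he, hze⟩ : ∃ e : ℂ, ‖e‖ = 1 ∧ z = ‖z‖ * e := by
    by_cases h : z = 0
    · exact ⟨1, by simp, by simp [h]⟩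
    · refine ⟨z / ‖z‖, by simp [h], ?_⟩
      have : (‖z‖ : ℂ) ≠ 0 := by simpa using h
      field_simp
  set r := ‖z‖ with hr
  have hr0 : 0 ≤ r := norm_nonneg z
  set s : ℝ := √2 / 2 with hs
  have hs2 : 2 * s ^ 2 = 1 := by
    rw [hs, div_pow, Real.sq_sqrt (by norm_num)]; norm_num
  have hs1 : 1 ≤ 2 * s := by
    have : 1 ≤ √2 := by
      rw [show (1 : ℝ) = √1 by simp]; exact Real.sqrt_le_sqrt (by norm_num)
    rw [hs]; linarith
  have key : ∀ t ∈ Set.Icc (0 : ℝ) 1, ∀ y : ℝ, y ^ 2 = t ^ 2 * s ^ 2 →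
      ‖(((r - t * s : ℝ) : ℂ) + (y : ℂ) * Complex.I) * e‖ ≤ 1 := by
    intro t ht y hy
    rw [norm_mul, he, mul_one]
    have h1 : ‖((r - t * s : ℝ) : ℂ) + (y : ℂ) * Complex.I‖ ^ 2 = (r - t * s) ^ 2 + y ^ 2 := by
      rw [← Complex.normSq_eq_norm_sq, Complex.normSq_add_mul_I]
    have h2 : (r - t * s) ^ 2 + y ^ 2 ≤ 1 := by
      have e1 : (r - t * s) ^ 2 + y ^ 2 = r ^ 2 - (2 * s) * (r * t) + t ^ 2 := by
        rw [hy]; linear_combination t ^ 2 * hs2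
      have h3 : r * t ≤ (2 * s) * (r * t) :=
        le_mul_of_one_le_left (mul_nonneg hr0 ht.1) hs1
      rw [e1]
      rcases le_total t r with h | h
      · nlinarith [mul_le_mul_of_nonneg_right h ht.1]
      · nlinarith [mul_le_mul_of_nonneg_right h hr0, ht.1, ht.2]
    nlinarith [norm_nonneg (((r - t * s : ℝ) : ℂ) + (y : ℂ) * Complex.I)]
  refine ⟨(-(s : ℂ) + s * Complex.I) * e, ?_, fun t ht => ⟨?_, ?_⟩⟩
  · rw [norm_mul, he, mul_one]
    have h1 : ‖-(s : ℂ) + s * Complex.I‖ ^ 2 = 1 := by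
      rw [← Complex.normSq_eq_norm_sq]
      have := Complex.normSq_add_mul_I (-s) s
      push_cast at this
      rw [this]; linarith
    nlinarith [norm_nonneg (-(s : ℂ) + s * Complex.I)]
  · have := key t ht (t * s) (by ring)
    convert! this using 2
    rw [hze]; push_cast; ring
  · have := key t ht (-(t * s)) (by ring)
    convert! this using 2
    rw [hze]; push_cast; linear_combination (t * s * e : ℂ) * Complex.I_sq

/-- **Markov-type inequality** on the disk. -/
lemma norm_wirt_le {n : ℕ} {p : ℂ → ℂ} (hp : p ∈ zPoly n) {M : ℝ}
    (hM : ∀ z ∈ closedBall (0 : ℂ) 1, ‖p z‖ ≤ M) {z : ℂ} (hz : z ∈ closedBall (0 : ℂ) 1)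
    {u w : ℂ} (hD : HasFDerivAt p (wirt u w) z) :
    ‖u‖ ≤ 4 * n ^ 2 * M ∧ ‖w‖ ≤ 4 * n ^ 2 * M := by
  obtain ⟨v, hv, hseg⟩ := exists_unit_segments (mem_closedBall_zero_iff.1 hz)
  have h1 := norm_fderiv_apply_le_of_segment hp hD
    (fun t ht => hM _ (mem_closedBall_zero_iff.2 (hseg t ht).1))
  have h2 := norm_fderiv_apply_le_of_segment hp hD
    (fun t ht => hM _ (mem_closedBall_zero_iff.2 (hseg t ht).2))
  simp only [wirt_apply, map_mul, Complex.conj_I] at h1 h2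
  have h2' : ‖u * v - w * starRingEnd ℂ v‖ ≤ 4 * n ^ 2 * M := by
    have e : u * (Complex.I * v) + w * (-Complex.I * starRingEnd ℂ v) =
        Complex.I * (u * v - w * starRingEnd ℂ v) := by ring
    rwa [e, norm_mul, Complex.norm_I, one_mul] at h2
  constructor
  · have : 2 * ‖u‖ = ‖(u * v + w * starRingEnd ℂ v) + (u * v - w * starRingEnd ℂ v)‖ := by
      rw [show (u * v + w * starRingEnd ℂ v) + (u * v - w * starRingEnd ℂ v) = 2 * (u * v) by ring]
      simp [hv]
    linarith [norm_add_le (u * v + w * starRingEnd ℂ v) (u * v - w * starRingEnd ℂ v)]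
  · have : 2 * ‖w‖ = ‖(u * v + w * starRingEnd ℂ v) - (u * v - w * starRingEnd ℂ v)‖ := by
      rw [show (u * v + w * starRingEnd ℂ v) - (u * v - w * starRingEnd ℂ v) =
        2 * (w * starRingEnd ℂ v) by ring]
      simp [hv]
    linarith [norm_sub_le (u * v + w * starRingEnd ℂ v) (u * v - w * starRingEnd ℂ v)]

lemma norm_wirt_clm_le (u w : ℂ) : ‖wirt u w‖ ≤ ‖u‖ + ‖w‖ := by
  refine ContinuousLinearMap.opNorm_le_bound _ (by positivity) fun h => ?_
  rw [wirt_apply]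
  refine (norm_add_le _ _).trans ?_
  simp [add_mul]

lemma norm_sub_le_of_mem_zPoly {n : ℕ} {p : ℂ → ℂ} (hp : p ∈ zPoly n) {M : ℝ}
    (hM : ∀ z ∈ closedBall (0 : ℂ) 1, ‖p z‖ ≤ M) {z w : ℂ} (hz : z ∈ closedBall (0 : ℂ) 1)
    (hw : w ∈ closedBall (0 : ℂ) 1) : ‖p w - p z‖ ≤ 8 * n ^ 2 * M * ‖w - z‖ := by
  obtain ⟨pz, hpz, pw, hpw, hD⟩ := exists_hasFDerivAt_of_mem_zPoly hp
  refine (convex_closedBall (0 : ℂ) 1).norm_image_sub_le_of_norm_hasFDerivWithin_le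
    (fun x _ => (hD x).hasFDerivWithinAt) (fun x hx => ?_) hz hw
  obtain ⟨h1, h2⟩ := norm_wirt_le hp hM hx (hD x)
  linarith [norm_wirt_clm_le (pz x) (pw x)]

/-- A sequence of polynomials of degree at most `j` whose sup norms on the disk decay faster than
any power of `j`. -/
def RapidSeq (q : ℕ → ℂ → ℂ) : Prop :=
  (∀ j, q j ∈ zPoly (j + 1)) ∧
    ∀ K : ℕ, ∃ C : ℝ, 0 ≤ C ∧ ∀ j : ℕ, ∀ z ∈ closedBall (0 : ℂ) 1, ‖q j z‖ ≤ C / ((j : ℝ) + 1) ^ K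

lemma summable_const_div_succ_sq (C : ℝ) : Summable fun j : ℕ => C / ((j : ℝ) + 1) ^ 2 := by
  have h := (summable_nat_add_iff 1).2 (Real.summable_one_div_nat_pow.2 (by norm_num : 1 < 2))
  refine (h.mul_left C).congr fun j => ?_
  push_cast
  ring

lemma RapidSeq.summable {q : ℕ → ℂ → ℂ} (hq : RapidSeq q) {z : ℂ}
    (hz : z ∈ closedBall (0 : ℂ) 1) : Summable fun j => q j z := by
  obtain ⟨C, -, hC⟩ := hq.2 2
  exact Summable.of_norm_bounded (summable_const_div_succ_sq C) fun j => hC j z hz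

lemma RapidSeq.continuousOn_tsum {q : ℕ → ℂ → ℂ} (hq : RapidSeq q) :
    ContinuousOn (fun z => ∑' j, q j z) (closedBall 0 1) := by
  obtain ⟨C, -, hC⟩ := hq.2 2
  exact _root_.continuousOn_tsum (fun j => (continuous_of_mem_zPoly (hq.1 j)).continuousOn)
    (summable_const_div_succ_sq C) fun j z hz => hC j z hz

lemma rapidSeq_of_le {q r : ℕ → ℂ → ℂ} (hq : RapidSeq q) (hr : ∀ j, r j ∈ zPoly (j + 1))
    {A : ℝ} {L : ℕ} (hA : 0 ≤ A) (h : ∀ (j : ℕ) (M : ℝ), (∀ z ∈ closedBall (0 : ℂ) 1, ‖q j z‖ ≤ M) →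
      ∀ z ∈ closedBall (0 : ℂ) 1, ‖r j z‖ ≤ A * ((j : ℝ) + 1) ^ L * M) : RapidSeq r := by
  refine ⟨hr, fun K => ?_⟩
  obtain ⟨C, hC0, hC⟩ := hq.2 (L + K)
  refine ⟨A * C, by positivity, fun j z hz => (h j _ (hC j) z hz).trans_eq ?_⟩
  rw [pow_add]
  field_simp

lemma RapidSeq.exists_wirt {q : ℕ → ℂ → ℂ} (hq : RapidSeq q) :
    ∃ qz qw : ℕ → ℂ → ℂ, RapidSeq qz ∧ RapidSeq qw ∧
      ∀ j z, HasFDerivAt (q j) (wirt (qz j z) (qw j z)) z := by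
  choose qz hqz qw hqw h using fun j => exists_hasFDerivAt_of_mem_zPoly (hq.1 j)
  refine ⟨qz, qw, ?_, ?_, h⟩
  · refine rapidSeq_of_le (A := 4) (L := 2) hq hqz (by norm_num) fun j M hM z hz => ?_
    simpa using (norm_wirt_le (hq.1 j) hM hz (h j z)).1
  · refine rapidSeq_of_le (A := 4) (L := 2) hq hqw (by norm_num) fun j M hM z hz => ?_
    simpa using (norm_wirt_le (hq.1 j) hM hz (h j z)).2

lemma hasSum_wirt {u w : ℕ → ℂ} (hu : Summable u) (hw : Summable w) :
    HasSum (fun j => wirt (u j) (w j)) (wirt (∑' j, u j) (∑' j, w j)) :=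
  (hu.hasSum.smul_const _).add (hw.hasSum.smul_const _)

lemma continuous_wirt : Continuous fun p : ℂ × ℂ => wirt p.1 p.2 := by
  unfold wirt
  fun_prop

lemma contDiff_wirt {n : WithTop ℕ∞} : ContDiff ℝ n fun p : ℂ × ℂ => wirt p.1 p.2 := by
  unfold wirt
  fun_prop

lemma closure_unit_ball : closure (ball (0 : ℂ) 1) = closedBall 0 1 := closure_ball 0 one_ne_zero

lemma uniqueDiffOn_closedUnitBall : UniqueDiffOn ℝ (closedBall (0 : ℂ) 1) := by
  refine uniqueDiffOn_convex (convex_closedBall _ _) ?_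
  rw [interior_closedBall _ one_ne_zero]
  exact ⟨0, by simp⟩

lemma RapidSeq.hasFDerivWithinAt {q qz qw : ℕ → ℂ → ℂ} (hq : RapidSeq q) (hz : RapidSeq qz)
    (hw : RapidSeq qw) (h : ∀ j z, HasFDerivAt (q j) (wirt (qz j z) (qw j z)) z) {z : ℂ}
    (hzz : z ∈ closedBall (0 : ℂ) 1) :
    HasFDerivWithinAt (fun z => ∑' j, q j z) (wirt (∑' j, qz j z) (∑' j, qw j z))
      (closedBall 0 1) z := by
  obtain ⟨C, -, hC⟩ := hz.2 2
  obtain ⟨D, -, hD⟩ := hw.2 2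
  have hint : ∀ x ∈ ball (0 : ℂ) 1, HasFDerivAt (fun z => ∑' j, q j z)
      (wirt (∑' j, qz j x) (∑' j, qw j x)) x := by
    intro x hx
    have := hasFDerivAt_tsum_of_isPreconnected (f := q) (f' := fun j z => wirt (qz j z) (qw j z))
      ((summable_const_div_succ_sq C).add (summable_const_div_succ_sq D))
      isOpen_ball (convex_ball (0 : ℂ) 1).isPreconnected (fun j y _ => h j y)
      (fun j y hy => (norm_wirt_clm_le _ _).trans
        (add_le_add (hC j y (ball_subset_closedBall hy)) (hD j y (ball_subset_closedBall hy))))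
      hx (hq.summable (ball_subset_closedBall hx)) hx
    rwa [(hasSum_wirt (hz.summable (ball_subset_closedBall hx))
      (hw.summable (ball_subset_closedBall hx))).tsum_eq] at this
  rw [← closure_unit_ball]
  refine hasFDerivWithinAt_closure_of_tendsto_fderiv
    (fun x hx => (hint x hx).differentiableAt.differentiableWithinAt) (convex_ball _ _) isOpen_ball
    (fun y hy => ?_) ?_
  · rw [closure_unit_ball] at hy
    exact (hq.continuousOn_tsum y hy).mono ball_subset_closedBall
  · have hc : ContinuousWithinAt (fun x => wirt (∑' j, qz j x) (∑' j, qw j x))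
        (closedBall 0 1) z :=
      continuous_wirt.continuousAt.comp_continuousWithinAt
        (f := fun x => (∑' j, qz j x, ∑' j, qw j x))
        ((hz.continuousOn_tsum z hzz).prodMk (hw.continuousOn_tsum z hzz))
    refine (hc.mono ball_subset_closedBall).tendsto.congr' ?_
    filter_upwards [self_mem_nhdsWithin] with x hx
    exact (hint x hx).fderiv.symm

theorem RapidSeq.cinfDisk {q : ℕ → ℂ → ℂ} (hq : RapidSeq q) :
    CinfDisk fun z => ∑' j, q j z := by
  rw [CinfDisk, contDiffOn_infty]
  intro n
  induction n generalizing q with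
  | zero => simpa using hq.continuousOn_tsum
  | succ n ih =>
    obtain ⟨qz, qw, hz, hw, h⟩ := hq.exists_wirt
    push_cast
    rw [contDiffOn_succ_iff_hasFDerivWithinAt_of_uniqueDiffOn uniqueDiffOn_closedUnitBall]
    refine ⟨by simp, fun z => wirt (∑' j, qz j z) (∑' j, qw j z), ?_,
      fun z hzz => hq.hasFDerivWithinAt hz hw h hzz⟩
    exact contDiff_wirt.comp_contDiffOn ((ih hz).prodMk (ih hw))

section Abstract

variable {E : Type*} [AddCommGroup E] [Module ℂ E] [FiniteDimensional ℂ E]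

/-- A symmetric operator with no real eigenvalue below `m` is bounded below by `m`. -/
lemma sq_mul_le_of_symmetric (c : InnerProductSpace.Core ℂ E) (T : E →ₗ[ℂ] E)
    (hT : ∀ x y, c.inner (T x) y = c.inner x (T y)) {m : ℝ} (hm : 0 < m)
    (hinj : ∀ μ : ℝ, μ < m → ∀ x, T x = (μ : ℂ) • x → x = 0) (x : E) :
    m ^ 2 * (c.inner x x).re ≤ (c.inner (T x) (T x)).re := by
  let : NormedAddCommGroup E := c.toNormedAddCommGroup
  let : InnerProductSpace ℂ E := InnerProductSpace.ofCore c.toCore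
  have hs : T.IsSymmetric := hT
  have hsq : ∀ y : E, (c.inner y y).re = ∑ i, ‖inner ℂ (hs.eigenvectorBasis rfl i) y‖ ^ 2 := by
    intro y
    rw [(hs.eigenvectorBasis rfl).sum_sq_norm_inner_right y]
    exact inner_self_eq_norm_sq (𝕜 := ℂ) y
  rw [hsq, hsq, Finset.mul_sum]
  refine Finset.sum_le_sum fun i _ => ?_
  have h1 : inner ℂ (hs.eigenvectorBasis rfl i) (T x) =
      (hs.eigenvalues rfl i : ℂ) * inner ℂ (hs.eigenvectorBasis rfl i) x := by
    rw [← hs, hs.apply_eigenvectorBasis, inner_smul_left]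
    simp
  have h2 : m ≤ hs.eigenvalues rfl i := by
    by_contra! h
    have h3 := hinj _ h (hs.eigenvectorBasis rfl i) (hs.apply_eigenvectorBasis rfl i)
    have h4 := (hs.eigenvectorBasis rfl).orthonormal.1 i
    rw [h3] at h4
    simp at h4
  rw [h1, norm_mul, mul_pow]
  gcongr
  simp only [norm_real, Real.norm_eq_abs]
  exact h2.trans (le_abs_self _)

/-- The Riesz representation of linear functionals for an inner product given by a core. -/
lemma exists_inner_eq (c : InnerProductSpace.Core ℂ E) (φ : E →ₗ[ℂ] ℂ) :
    ∃ x, ∀ y, c.inner x y = φ y := by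
  let : NormedAddCommGroup E := c.toNormedAddCommGroup
  let : InnerProductSpace ℂ E := InnerProductSpace.ofCore c.toCore
  have : CompleteSpace E := FiniteDimensional.complete ℂ E
  refine ⟨(InnerProductSpace.toDual ℂ E).symm (LinearMap.toContinuousLinearMap φ), fun y => ?_⟩
  exact InnerProductSpace.toDual_symm_apply

end Abstract

lemma intervalIntegrable_weight {γ : ℝ} (hγ : -1 < γ) :
    IntervalIntegrable (fun u : ℝ => (1 - u ^ 2) ^ γ) volume (-1) 1 := by
  have h0 : IntervalIntegrable (fun u : ℝ => (1 - u ^ 2) ^ γ) volume 0 1 := by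
    have h1 : IntervalIntegrable (fun u : ℝ => (1 - u) ^ γ) volume 0 1 := by
      have := (intervalIntegral.intervalIntegrable_rpow' (a := 0) (b := 1) hγ).comp_sub_left 1
      simpa using this.symm
    have h2 : IntervalIntegrable (fun u : ℝ => (1 - u) ^ γ * (1 + u) ^ γ) volume 0 1 := by
      refine h1.mul_continuousOn (ContinuousOn.rpow_const (by fun_prop) fun x hx => Or.inl ?_)
      rw [uIcc_of_le zero_le_one] at hx
      linarith [hx.1]
    refine h2.congr fun u hu => ?_
    rw [uIoc_of_le zero_le_one] at hu
    rw [← Real.mul_rpow (by linarith [hu.2]) (by linarith [hu.1])]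
    ring_nf
  have h1 : IntervalIntegrable (fun u : ℝ => (1 - u ^ 2) ^ γ) volume (-1) 0 := by
    simpa using (h0.comp_sub_left 0).symm
  exact h1.trans h0

/-- The weight `(1 - |z|²)^γ` on the disk. -/
def dwt (γ : ℝ) (z : ℂ) : ℝ := (1 - ‖z‖ ^ 2) ^ γ

lemma dwt_nonneg (γ : ℝ) {z : ℂ} (hz : z ∈ closedBall (0 : ℂ) 1) : 0 ≤ dwt γ z := by
  have := mem_closedBall_zero_iff.1 hz
  exact Real.rpow_nonneg (by nlinarith [norm_nonneg z]) _

lemma integrableOn_dwt {γ : ℝ} (hγ : -1 < γ) : IntegrableOn (dwt γ) (closedBall 0 1) := by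
  have h : IntegrableOn (dwt γ) (ball 0 1) := by
    refine (integrableOn_fun_norm_addHaar (volume : Measure ℂ)
      (f := fun r : ℝ => (1 - r ^ 2) ^ γ)).2 ?_
    rw [Complex.finrank_real_complex]
    have h1 := ((intervalIntegrable_weight hγ).mono_set (a := -1) (b := 1) (c := 0) (d := 1)
      (by simp [uIcc_of_le]; intro x hx; exact ⟨by linarith [hx.1], hx.2⟩)).continuousOn_mul
      (continuous_id.continuousOn (s := uIcc (0:ℝ) 1))
    rw [intervalIntegrable_iff_integrableOn_Ioo_of_le zero_le_one] at h1
    simpa using h1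
  have h2 : (closedBall (0 : ℂ) 1 : Set ℂ) =ᵐ[volume] ball 0 1 := by
    rw [← sphere_union_ball]
    refine union_ae_eq_right_of_ae_eq_empty (ae_eq_empty.2 ?_)
    exact Measure.addHaar_sphere _ _ _
  exact h.congr_set_ae h2

/-- The bilinear form `∫ f g d^γ` on the disk. -/
def wip (γ : ℝ) (f g : ℂ → ℂ) : ℂ :=
  ∫ z in closedBall (0 : ℂ) 1, (dwt γ z : ℂ) * (f z * g z)

lemma integrableOn_dwt_mul {γ : ℝ} (hγ : -1 < γ) {f : ℂ → ℂ}
    (hf : ContinuousOn f (closedBall 0 1)) :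
    IntegrableOn (fun z => (dwt γ z : ℂ) * f z) (closedBall 0 1) := by
  have h : IntegrableOn (fun z => (dwt γ z : ℂ)) (closedBall 0 1) := (integrableOn_dwt hγ).ofReal
  exact h.mul_continuousOn hf (isCompact_closedBall 0 1)

lemma wip_comm (γ : ℝ) (f g : ℂ → ℂ) : wip γ f g = wip γ g f := by
  simp only [wip, mul_comm (f _)]

lemma wip_add_left {γ : ℝ} (hγ : -1 < γ) {f₁ f₂ g : ℂ → ℂ} (h1 : ContinuousOn f₁ (closedBall 0 1))
    (h2 : ContinuousOn f₂ (closedBall 0 1)) (hg : ContinuousOn g (closedBall 0 1)) :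
    wip γ (f₁ + f₂) g = wip γ f₁ g + wip γ f₂ g := by
  refine Eq.trans ?_ (integral_add (integrableOn_dwt_mul hγ (h1.mul hg))
    (integrableOn_dwt_mul hγ (h2.mul hg)))
  rw [wip]
  congr 1
  ext z
  simp only [Pi.add_apply]
  ring

lemma wip_smul_left (γ : ℝ) (c : ℂ) (f g : ℂ → ℂ) : wip γ (c • f) g = c * wip γ f g := by
  rw [wip, wip, ← integral_const_mul]
  congr 1
  ext z
  simp only [Pi.smul_apply, smul_eq_mul]
  ring

lemma wip_star (γ : ℝ) (f g : ℂ → ℂ) : starRingEnd ℂ (wip γ f g) = wip γ (star f) (star g) := by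
  rw [wip, wip, ← integral_conj]
  simp

lemma wip_congr {γ : ℝ} {f₁ f₂ g₁ g₂ : ℂ → ℂ} (hf : EqOn f₁ f₂ (closedBall 0 1))
    (hg : EqOn g₁ g₂ (closedBall 0 1)) : wip γ f₁ g₁ = wip γ f₂ g₂ := by
  refine setIntegral_congr_fun measurableSet_closedBall fun z hz => ?_
  simp only [hf hz, hg hz]

lemma wip_star_self (γ : ℝ) (f : ℂ → ℂ) :
    wip γ (star f) f = ((∫ z in closedBall (0 : ℂ) 1, dwt γ z * ‖f z‖ ^ 2 : ℝ) : ℂ) := by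
  refine Eq.trans ?_ integral_ofReal
  rw [wip]
  congr 1
  ext z
  simp [← Complex.conj_mul']

lemma norm_wip_le {γ : ℝ} (hγ : -1 < γ) {f g : ℂ → ℂ} {A B : ℝ}
    (hf : ∀ z ∈ closedBall (0 : ℂ) 1, ‖f z‖ ≤ A) (hg : ∀ z ∈ closedBall (0 : ℂ) 1, ‖g z‖ ≤ B) :
    ‖wip γ f g‖ ≤ (∫ z in closedBall (0 : ℂ) 1, dwt γ z) * (A * B) := by
  rw [← integral_mul_const]
  refine norm_integral_le_of_norm_le ((integrableOn_dwt hγ).mul_const _)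
    ((ae_restrict_iff' measurableSet_closedBall).2 (ae_of_all _ fun z hz => ?_))
  have h0 := dwt_nonneg γ hz
  rw [norm_mul, norm_mul, norm_real, Real.norm_of_nonneg h0]
  have := hf z hz
  have := hg z hz
  have : 0 ≤ A := (norm_nonneg _).trans (hf z hz)
  gcongr

/-- Nikolskii inequality: the sup norm on polynomials of degree less than `n` is controlled by the
weighted `L²` norm up to a polynomial factor in `n`. -/
lemma exists_nikolskii {γ : ℝ} (hγ : -1 < γ) : ∃ (C : ℝ) (K : ℕ), 0 < C ∧
    ∀ (n : ℕ) (p : ℂ → ℂ), p ∈ zPoly n → ∀ z ∈ closedBall (0 : ℂ) 1,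
      ‖p z‖ ^ 2 ≤ C * ((n : ℝ) + 1) ^ K * ∫ z in closedBall (0 : ℂ) 1, dwt γ z * ‖p z‖ ^ 2 := by
  obtain ⟨N, hN⟩ := exists_nat_ge γ
  refine ⟨4 / π * 48 ^ (N + 2), 2 * (N + 2), by positivity, fun n p hp z hz => ?_⟩
  have hpc := continuous_of_mem_zPoly hp
  obtain ⟨z0, hz0, hmax⟩ := (isCompact_closedBall (0 : ℂ) 1).exists_isMaxOn ⟨0, by simp⟩
    hpc.norm.continuousOn
  have hM : ∀ z ∈ closedBall (0 : ℂ) 1, ‖p z‖ ≤ ‖p z0‖ := fun z hz => hmax hz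
  set M := ‖p z0‖ with hMdef
  have hM0 : 0 ≤ M := norm_nonneg _
  set r : ℝ := 1 / (24 * ((n : ℝ) + 1) ^ 2) with hr
  have hr0 : 0 < r := by positivity
  have hr1 : r ≤ 1 := by
    rw [hr, div_le_one (by positivity)]
    nlinarith [(Nat.cast_nonneg n : (0 : ℝ) ≤ n)]
  have hz0' := mem_closedBall_zero_iff.1 hz0
  have hball : ∀ w ∈ ball (((1 - r : ℝ) : ℂ) * z0) (r / 2),
      w ∈ closedBall (0 : ℂ) 1 ∧ (r / 2) ^ N * (M / 2) ^ 2 ≤ dwt γ w * ‖p w‖ ^ 2 := by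
    intro w hw
    rw [mem_ball_iff_norm] at hw
    have h1 : ‖w‖ ≤ 1 - r / 2 := by
      have h2 : ‖((1 - r : ℝ) : ℂ) * z0‖ ≤ 1 - r := by
        rw [norm_mul, norm_real, Real.norm_of_nonneg (by linarith)]
        nlinarith
      have h3 := norm_le_norm_add_norm_sub' w (((1 - r : ℝ) : ℂ) * z0)
      linarith
    have hwm : w ∈ closedBall (0 : ℂ) 1 := mem_closedBall_zero_iff.2 (by linarith)
    refine ⟨hwm, ?_⟩
    have h4 : ‖w - z0‖ ≤ 3 * r / 2 := by
      have : w - z0 = (w - ((1 - r : ℝ) : ℂ) * z0) - (r : ℂ) * z0 := by push_cast; ring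
      rw [this]
      refine (norm_sub_le _ _).trans ?_
      rw [norm_mul, norm_real, Real.norm_of_nonneg hr0.le]
      nlinarith
    have h5 : M / 2 ≤ ‖p w‖ := by
      have h6 := norm_sub_le_of_mem_zPoly hp hM hz0 hwm
      have h7 : 8 * (n : ℝ) ^ 2 * M * ‖w - z0‖ ≤ M / 2 := by
        calc 8 * (n : ℝ) ^ 2 * M * ‖w - z0‖ ≤ 8 * ((n : ℝ) + 1) ^ 2 * M * (3 * r / 2) := by
              gcongr
              linarith
          _ = M / 2 := by rw [hr]; field_simp; ring
      have h8 := norm_sub_norm_le (p z0) (p w)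
      rw [norm_sub_rev] at h8
      linarith
    have hd : r / 2 ≤ 1 - ‖w‖ ^ 2 := by nlinarith [norm_nonneg w]
    have h9 : (r / 2) ^ N ≤ dwt γ w := by
      calc (r / 2) ^ N ≤ (1 - ‖w‖ ^ 2) ^ N := by gcongr
        _ = (1 - ‖w‖ ^ 2) ^ (N : ℝ) := (Real.rpow_natCast _ _).symm
        _ ≤ dwt γ w := Real.rpow_le_rpow_of_exponent_ge (by linarith)
            (by nlinarith [norm_nonneg w]) hN
    have : 0 ≤ dwt γ w := dwt_nonneg γ hwm
    gcongr
  have hint : IntegrableOn (fun z => dwt γ z * ‖p z‖ ^ 2) (closedBall 0 1) :=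
    (integrableOn_dwt hγ).mul_continuousOn (by fun_prop) (isCompact_closedBall 0 1)
  have hlow : π * (r / 2) ^ 2 * ((r / 2) ^ N * (M / 2) ^ 2) ≤
      ∫ z in closedBall (0 : ℂ) 1, dwt γ z * ‖p z‖ ^ 2 := by
    calc _ = ∫ w in ball (((1 - r : ℝ) : ℂ) * z0) (r / 2), (r / 2) ^ N * (M / 2) ^ 2 := by
          rw [setIntegral_const, Measure.real, Complex.volume_ball]
          simp only [ENNReal.toReal_mul, ENNReal.toReal_pow, smul_eq_mul,
            ENNReal.toReal_ofReal (half_pos hr0).le, ENNReal.coe_toReal, NNReal.coe_real_pi]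
          ring
      _ ≤ ∫ w in ball (((1 - r : ℝ) : ℂ) * z0) (r / 2), dwt γ w * ‖p w‖ ^ 2 := by
          refine setIntegral_mono_on (integrableOn_const measure_ball_lt_top.ne) (hint.mono_set fun w hw => (hball w hw).1)
            measurableSet_ball fun w hw => (hball w hw).2
      _ ≤ _ := by
          refine setIntegral_mono_set hint ?_ (Filter.Eventually.of_forall fun w hw => (hball w hw).1)
          refine (ae_restrict_iff' measurableSet_closedBall).2 (ae_of_all _ fun z hz => ?_)
          exact mul_nonneg (dwt_nonneg γ hz) (by positivity)
  calc ‖p z‖ ^ 2 ≤ M ^ 2 := by gcongr; exact hM z hz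
    _ = 4 / π * 48 ^ (N + 2) * ((n : ℝ) + 1) ^ (2 * (N + 2)) *
        (π * (r / 2) ^ 2 * ((r / 2) ^ N * (M / 2) ^ 2)) := by
      have h10 : 48 ^ (N + 2) * ((n : ℝ) + 1) ^ (2 * (N + 2)) * ((r / 2) ^ 2 * (r / 2) ^ N) = 1 := by
        rw [pow_mul, ← mul_pow, ← pow_add, add_comm 2 N, ← mul_pow, hr]
        convert! one_pow _
        field_simp
        norm_num
      have : 4 / π * 48 ^ (N + 2) * ((n : ℝ) + 1) ^ (2 * (N + 2)) *
        (π * (r / 2) ^ 2 * ((r / 2) ^ N * (M / 2) ^ 2)) = (4 / π * π) * (M / 2) ^ 2 *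
        (48 ^ (N + 2) * ((n : ℝ) + 1) ^ (2 * (N + 2)) * ((r / 2) ^ 2 * (r / 2) ^ N)) := by ring
      rw [this, h10]
      field_simp
      norm_num
    _ ≤ _ := by gcongr

/-- The weighted inner product on polynomials. -/
abbrev zCore {γ : ℝ} (hγ : -1 < γ) (n : ℕ) : InnerProductSpace.Core ℂ (zPoly n) where
  inner p q := wip γ (star (p : ℂ → ℂ)) q
  conj_inner_symm p q := by
    rw [wip_star, star_star, wip_comm]
  re_inner_nonneg p := by
    rw [wip_star_self]
    refine setIntegral_nonneg measurableSet_closedBall fun z hz => ?_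
    exact mul_nonneg (dwt_nonneg γ hz) (by positivity)
  add_left p q s := by
    rw [Submodule.coe_add, star_add, wip_add_left hγ]
    · exact (continuous_of_mem_zPoly (star_mem_zPoly p.2)).continuousOn
    · exact (continuous_of_mem_zPoly (star_mem_zPoly q.2)).continuousOn
    · exact (continuous_of_mem_zPoly s.2).continuousOn
  smul_left p q c := by
    rw [Submodule.coe_smul, star_smul, wip_smul_left]
    rfl
  definite p h := by
    obtain ⟨C, K, hC, hCK⟩ := exists_nikolskii hγ
    rw [wip_star_self, Complex.ofReal_eq_zero] at h
    refine Subtype.ext (eq_zero_of_eqOn_closedBall p.2 fun z hz => ?_)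
    have := hCK n p p.2 z hz
    rw [h, mul_zero] at this
    simpa using le_antisymm this (by positivity)

/-- The point with coordinates `(√(1-x²) u, x)` in the frame rotated by `θ`. -/
def slicePt (θ x u : ℝ) : ℂ :=
  Complex.exp ((θ : ℂ) * Complex.I) * ((√(1 - x ^ 2) * u : ℝ) + x * Complex.I)

/-- Normalized weighted integral of `f` over the chord of direction `θ` at signed distance `x` from
the origin. -/
def slice (γ : ℝ) (f : ℂ → ℂ) (θ x : ℝ) : ℂ :=
  ∫ u in (-1 : ℝ)..1, (((1 - u ^ 2) ^ γ : ℝ) : ℂ) * f (slicePt θ x u)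

/-- The signed distance from the origin to the line through `z` of direction `θ`. -/
def lineOffset (z : ℂ) (θ : ℝ) : ℝ := (z * Complex.exp (-(θ : ℂ) * Complex.I)).im

lemma norm_exp_neg_ofReal_mul_I (θ : ℝ) : ‖Complex.exp (-(θ : ℂ) * Complex.I)‖ = 1 := by
  rw [← Complex.ofReal_neg, Complex.norm_exp_ofReal_mul_I]

lemma abs_lineOffset_le {z : ℂ} (hz : z ∈ closedBall (0 : ℂ) 1) (θ : ℝ) : |lineOffset z θ| ≤ 1 := by
  refine (Complex.abs_im_le_norm _).trans ?_
  rw [norm_mul, norm_exp_neg_ofReal_mul_I, mul_one]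
  exact mem_closedBall_zero_iff.1 hz

lemma norm_slicePt_sq (θ u : ℝ) {x : ℝ} (hx : |x| ≤ 1) :
    ‖slicePt θ x u‖ ^ 2 = (1 - x ^ 2) * u ^ 2 + x ^ 2 := by
  have h : 0 ≤ 1 - x ^ 2 := by nlinarith [abs_le.1 hx]
  rw [slicePt, norm_mul, Complex.norm_exp_ofReal_mul_I, one_mul, ← Complex.normSq_eq_norm_sq,
    Complex.normSq_add_mul_I, mul_pow, Real.sq_sqrt h]

lemma slicePt_mem {θ x u : ℝ} (hx : |x| ≤ 1) (hu : |u| ≤ 1) :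
    slicePt θ x u ∈ closedBall (0 : ℂ) 1 := by
  have h := norm_slicePt_sq θ u hx
  have h1 : 0 ≤ 1 - x ^ 2 := by nlinarith [abs_le.1 hx]
  have h2 : u ^ 2 ≤ 1 := by nlinarith [abs_le.1 hu]
  rw [mem_closedBall_zero_iff]
  have : ‖slicePt θ x u‖ ^ 2 ≤ 1 := by rw [h]; nlinarith
  nlinarith [norm_nonneg (slicePt θ x u)]

lemma chord_wrap (β α t : ℝ) : chord (wrap β) α t = chord β α t := by
  have h : ∃ k : ℤ, wrap β = β - k * (2 * π) := ⟨toIocDiv Real.two_pi_pos 0 β, by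
    rw [wrap, toIocMod, zsmul_eq_mul]⟩
  obtain ⟨k, hk⟩ := h
  have e : ∀ s : ℝ, Complex.exp (((s - k * (2 * π) : ℝ) : ℂ) * Complex.I) =
      Complex.exp ((s : ℂ) * Complex.I) := by
    intro s
    rw [Complex.exp_eq_exp_iff_exists_int]
    exact ⟨-k, by push_cast; ring⟩
  rw [chord, chord, hk, e, show β - k * (2 * π) + π + α = β + π + α - k * (2 * π) by ring, e]

lemma chord_betam (z : ℂ) (hz : z ∈ closedBall (0 : ℂ) 1) (θ t : ℝ) :
    chord (betam z θ) (alpham z θ) t = Complex.exp ((θ : ℂ) * Complex.I) *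
      (((t - √(1 - lineOffset z θ ^ 2) : ℝ) : ℂ) + lineOffset z θ * Complex.I) := by
  have hx := abs_le.1 (abs_lineOffset_le hz θ)
  have hs : Real.sin (alpham z θ) = lineOffset z θ := Real.sin_arcsin hx.1 hx.2
  have hc : Real.cos (alpham z θ) = √(1 - lineOffset z θ ^ 2) := Real.cos_arcsin _
  rw [chord, betam, ← hc, ← hs]
  have e1 : ((θ - π - alpham z θ : ℝ) : ℂ) * Complex.I =
      (θ : ℂ) * Complex.I + (-(π * Complex.I) + ((-alpham z θ : ℝ) : ℂ) * Complex.I) := by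
    push_cast; ring
  rw [e1, Complex.exp_add, Complex.exp_add, Complex.exp_neg, Complex.exp_pi_mul_I, Complex.exp_mul_I,
    Complex.exp_mul_I (((-alpham z θ : ℝ) : ℂ)), ← Complex.ofReal_cos (-alpham z θ),
    ← Complex.ofReal_sin (-alpham z θ), Real.cos_neg, Real.sin_neg,
    show θ - π - alpham z θ + π + alpham z θ = θ by ring, Complex.exp_mul_I]
  push_cast
  ring

lemma countable_tangent {z : ℂ} (hz : z ∈ closedBall (0 : ℂ) 1) :
    {θ : ℝ | ¬ 0 < 1 - lineOffset z θ ^ 2}.Countable := by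
  refine (countable_range fun k : ℤ => z.arg - (2 * k + 1) * π / 2).mono ?_
  intro θ hθ
  have hx : lineOffset z θ = ‖z‖ * Real.sin (z.arg - θ) := by
    rw [lineOffset]
    conv_lhs => rw [← Complex.norm_mul_exp_arg_mul_I z]
    rw [mul_assoc, ← Complex.exp_add, ← add_mul, ← sub_eq_add_neg, ← Complex.ofReal_sub,
      Complex.im_ofReal_mul, Complex.exp_ofReal_mul_I_im]
  have hz' := mem_closedBall_zero_iff.1 hz
  have h1 := Real.sin_sq_add_cos_sq (z.arg - θ)
  have h2 : Real.cos (z.arg - θ) = 0 := by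
    simp only [mem_ofPred_eq, not_lt, hx, mul_pow] at hθ
    have : ‖z‖ ^ 2 ≤ 1 := by nlinarith [norm_nonneg z]
    have : ‖z‖ ^ 2 * Real.sin (z.arg - θ) ^ 2 ≤ Real.sin (z.arg - θ) ^ 2 := by
      nlinarith [sq_nonneg (Real.sin (z.arg - θ))]
    nlinarith [sq_nonneg (Real.cos (z.arg - θ))]
  obtain ⟨k, hk⟩ := Real.cos_eq_zero_iff.1 h2
  exact ⟨k, by simp only; rw [← hk]; ring⟩

lemma Nop_eq (γ : ℝ) (f : ℂ → ℂ) {z : ℂ} (hz : z ∈ closedBall (0 : ℂ) 1) :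
    Nop γ f z = ∫ θ in (0 : ℝ)..(2 * π), slice γ f θ (lineOffset z θ) := by
  rw [Nop, BPW, BP]
  refine intervalIntegral.integral_congr_ae' ?_ ?_
  swap
  · refine ae_of_all _ fun θ hθ => ?_
    simp at hθ
    linarith [Real.pi_pos]
  have hae : ∀ᵐ θ : ℝ, 0 < 1 - lineOffset z θ ^ 2 := (countable_tangent hz).measure_zero _
  filter_upwards [hae] with θ hθ _
  set x := lineOffset z θ with hxdef
  have hx := abs_lineOffset_le hz θ
  have hc : Real.cos (alpham z θ) = √(1 - x ^ 2) := Real.cos_arcsin _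
  set c := √(1 - x ^ 2) with hcdef
  have hc0 : 0 < c := Real.sqrt_pos.2 hθ
  have hcc : c ^ 2 = 1 - x ^ 2 := Real.sq_sqrt hθ.le
  simp only [XRT]
  rw [hc]
  have hsub : (∫ t in (0 : ℝ)..(2 * c), (fun w => (((1 - ‖w‖ ^ 2) ^ γ : ℝ) : ℂ) * f w)
      (chord (wrap (betam z θ)) (alpham z θ) t)) = (c : ℂ) * ∫ u in (-1 : ℝ)..1,
        (fun w => (((1 - ‖w‖ ^ 2) ^ γ : ℝ) : ℂ) * f w) (slicePt θ x u) := by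
    have h := intervalIntegral.smul_integral_comp_mul_add (a := -1) (b := 1)
      (fun t => (fun w => (((1 - ‖w‖ ^ 2) ^ γ : ℝ) : ℂ) * f w)
        (chord (wrap (betam z θ)) (alpham z θ) t)) c c
    rw [show c * -1 + c = 0 by ring, show c * 1 + c = 2 * c by ring] at h
    rw [← h, Complex.real_smul]
    congr 2
    ext u
    have : chord (wrap (betam z θ)) (alpham z θ) (c * u + c) = slicePt θ x u := by
      rw [chord_wrap, chord_betam z hz, slicePt, ← hxdef, ← hcdef]
      congr 4
      ring
    rw [this]
  simp only at hsub
  rw [hsub, ← mul_assoc, slice, ← intervalIntegral.integral_const_mul]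
  refine intervalIntegral.integral_congr fun u hu => ?_
  rw [uIcc_of_le (by norm_num)] at hu
  have hu2 : 0 ≤ 1 - u ^ 2 := by nlinarith [hu.1, hu.2]
  rw [norm_slicePt_sq θ u hx, show 1 - ((1 - x ^ 2) * u ^ 2 + x ^ 2) = c ^ 2 * (1 - u ^ 2) by
    rw [hcc]; ring, Real.mul_rpow (by positivity) hu2, ← mul_assoc]
  congr 1
  have h1 : c ^ (-(2 * γ) - 1) * c * (c ^ 2) ^ γ = 1 := by
    rw [← Real.rpow_natCast, ← Real.rpow_mul hc0.le, ← Real.rpow_add_one hc0.ne',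
      ← Real.rpow_add hc0]
    norm_num
  have h2 : ((c ^ (-(2 * γ) - 1) : ℝ) : ℂ) * (c : ℂ) * (((c ^ 2) ^ γ : ℝ) : ℂ) = 1 := by
    exact_mod_cast h1
  rw [Complex.ofReal_mul ((c ^ 2) ^ γ)]
  linear_combination (((1 - u ^ 2) ^ γ : ℝ) : ℂ) * h2

lemma slice_congr {γ : ℝ} {f g : ℂ → ℂ} (h : EqOn f g (closedBall 0 1)) {θ x : ℝ} (hx : |x| ≤ 1) :
    slice γ f θ x = slice γ g θ x := by
  refine intervalIntegral.integral_congr fun u hu => ?_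
  rw [uIcc_of_le (by norm_num)] at hu
  simp only [h (slicePt_mem hx (abs_le.2 hu))]

lemma Nop_congr {γ : ℝ} {f g : ℂ → ℂ} (h : EqOn f g (closedBall 0 1)) :
    EqOn (Nop γ f) (Nop γ g) (closedBall 0 1) := by
  intro z hz
  rw [Nop_eq γ f hz, Nop_eq γ g hz]
  exact intervalIntegral.integral_congr fun θ _ => slice_congr h (abs_lineOffset_le hz θ)

/-- Total mass of the weight `(1-u²)^γ` on `[-1,1]`. -/
def wmass (γ : ℝ) : ℝ := ∫ u in (-1 : ℝ)..1, (1 - u ^ 2) ^ γ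

lemma wmass_nonneg (γ : ℝ) : 0 ≤ wmass γ :=
  intervalIntegral.integral_nonneg (by norm_num) fun u hu =>
    Real.rpow_nonneg (by nlinarith [hu.1, hu.2]) _

lemma norm_slice_le {γ : ℝ} (hγ : -1 < γ) {f : ℂ → ℂ} {M : ℝ}
    (hf : ∀ z ∈ closedBall (0 : ℂ) 1, ‖f z‖ ≤ M) {θ x : ℝ} (hx : |x| ≤ 1) :
    ‖slice γ f θ x‖ ≤ wmass γ * M := by
  rw [slice, wmass, ← intervalIntegral.integral_mul_const]
  refine intervalIntegral.norm_integral_le_of_norm_le (by norm_num) (ae_of_all _ fun u hu => ?_)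
    ((intervalIntegrable_weight hγ).mul_const _)
  have h : 0 ≤ (1 - u ^ 2) ^ γ := Real.rpow_nonneg (by nlinarith [hu.1, hu.2]) _
  rw [norm_mul, norm_real, Real.norm_of_nonneg h]
  exact mul_le_mul_of_nonneg_left (hf _ (slicePt_mem hx (abs_le.2 ⟨hu.1.le, hu.2⟩))) h

lemma norm_Nop_le {γ : ℝ} (hγ : -1 < γ) {f : ℂ → ℂ} {M : ℝ}
    (hf : ∀ z ∈ closedBall (0 : ℂ) 1, ‖f z‖ ≤ M) {z : ℂ} (hz : z ∈ closedBall (0 : ℂ) 1) :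
    ‖Nop γ f z‖ ≤ 2 * π * wmass γ * M := by
  rw [Nop_eq γ f hz]
  have := intervalIntegral.norm_integral_le_of_norm_le_const (a := 0) (b := 2 * π)
    (f := fun θ => slice γ f θ (lineOffset z θ)) (C := wmass γ * M)
    fun θ _ => norm_slice_le hγ hf (abs_lineOffset_le hz θ)
  rw [sub_zero, abs_of_pos Real.two_pi_pos] at this
  linarith

/-- Radial extension of a function from the closed unit disk. -/
def radExt (f : ℂ → ℂ) (z : ℂ) : ℂ := f (z / (max 1 ‖z‖ : ℝ))

lemma div_max_mem (z : ℂ) : z / (max 1 ‖z‖ : ℝ) ∈ closedBall (0 : ℂ) 1 := by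
  have h : 0 < max 1 ‖z‖ := lt_max_of_lt_left one_pos
  rw [mem_closedBall_zero_iff, norm_div, norm_real, Real.norm_of_nonneg h.le, div_le_one h]
  exact le_max_right _ _

lemma radExt_eqOn (f : ℂ → ℂ) : EqOn (radExt f) f (closedBall 0 1) := by
  intro z hz
  rw [radExt, max_eq_left (mem_closedBall_zero_iff.1 hz)]
  simp

lemma continuous_radExt {f : ℂ → ℂ} (hf : ContinuousOn f (closedBall 0 1)) :
    Continuous (radExt f) := by
  refine hf.comp_continuous ?_ div_max_mem
  refine continuous_id.div (by fun_prop) fun z => ?_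
  have h : 0 < max 1 ‖z‖ := lt_max_of_lt_left one_pos
  exact_mod_cast h.ne'

lemma exists_bound_radExt {f : ℂ → ℂ} (hf : ContinuousOn f (closedBall 0 1)) :
    ∃ M, ∀ z, ‖radExt f z‖ ≤ M := by
  obtain ⟨M, hM⟩ := (isCompact_closedBall (0 : ℂ) 1).exists_bound_of_continuousOn hf
  exact ⟨M, fun z => hM _ (div_max_mem z)⟩

lemma continuous_slicePt : Continuous fun p : ℝ × ℝ × ℝ => slicePt p.1 p.2.1 p.2.2 := by
  unfold slicePt
  fun_prop

lemma intervalIntegrable_slice {γ : ℝ} (hγ : -1 < γ) {f : ℂ → ℂ} (hf : Continuous f) (θ x : ℝ) :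
    IntervalIntegrable (fun u : ℝ => (((1 - u ^ 2) ^ γ : ℝ) : ℂ) * f (slicePt θ x u)) volume
      (-1) 1 := by
  refine IntervalIntegrable.mul_continuousOn (f := fun u : ℝ => (((1 - u ^ 2) ^ γ : ℝ) : ℂ))
    ⟨(intervalIntegrable_weight hγ).1.ofReal, (intervalIntegrable_weight hγ).2.ofReal⟩ ?_
  exact (hf.comp (continuous_slicePt.comp
    (by fun_prop : Continuous fun u : ℝ => (θ, x, u)))).continuousOn

lemma continuous_slice {γ : ℝ} (hγ : -1 < γ) {f : ℂ → ℂ} (hf : Continuous f) {M : ℝ}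
    (hM : ∀ z, ‖f z‖ ≤ M) : Continuous fun p : ℝ × ℝ => slice γ f p.1 p.2 := by
  refine intervalIntegral.continuous_of_dominated_interval
    (bound := fun u => ‖(1 - u ^ 2) ^ γ‖ * M) (fun p => ?_) (fun p => ?_) ?_ ?_
  · exact (intervalIntegrable_slice hγ hf p.1 p.2).def'.aestronglyMeasurable
  · refine ae_of_all _ fun u _ => ?_
    rw [norm_mul, norm_real]
    exact mul_le_mul_of_nonneg_left (hM _) (norm_nonneg _)
  · exact (intervalIntegrable_weight hγ).norm.mul_const _
  · refine ae_of_all _ fun u _ => continuous_const.mul (hf.comp ?_)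
    exact continuous_slicePt.comp (by fun_prop : Continuous fun p : ℝ × ℝ => (p.1, p.2, u))

lemma continuous_lineOffset : Continuous fun p : ℂ × ℝ => lineOffset p.1 p.2 := by
  unfold lineOffset
  fun_prop

lemma Nop_add {γ : ℝ} (hγ : -1 < γ) {f g : ℂ → ℂ} (hf : ContinuousOn f (closedBall 0 1))
    (hg : ContinuousOn g (closedBall 0 1)) {z : ℂ} (hz : z ∈ closedBall (0 : ℂ) 1) :
    Nop γ (f + g) z = Nop γ f z + Nop γ g z := by
  have hf' := continuous_radExt hf
  have hg' := continuous_radExt hg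
  obtain ⟨M, hM⟩ := exists_bound_radExt hf
  obtain ⟨N, hN⟩ := exists_bound_radExt hg
  have h : EqOn (f + g) (radExt f + radExt g) (closedBall 0 1) := fun z hz => by
    simp [radExt_eqOn f hz, radExt_eqOn g hz]
  have hl : Continuous fun θ : ℝ => (θ, lineOffset z θ) :=
    continuous_id.prodMk (continuous_lineOffset.comp (by fun_prop : Continuous fun θ : ℝ => (z, θ)))
  rw [Nop_congr h hz, Nop_congr (radExt_eqOn f).symm hz, Nop_congr (radExt_eqOn g).symm hz,
    Nop_eq γ _ hz, Nop_eq γ _ hz, Nop_eq γ _ hz]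
  refine Eq.trans ?_ (intervalIntegral.integral_add
      (((continuous_slice hγ hf' hM).comp hl).intervalIntegrable _ _)
      (((continuous_slice hγ hg' hN).comp hl).intervalIntegrable _ _))
  refine intervalIntegral.integral_congr fun θ _ => ?_
  simp only [slice]
  rw [← intervalIntegral.integral_add (intervalIntegrable_slice hγ hf' _ _)
    (intervalIntegrable_slice hγ hg' _ _)]
  simp only [Pi.add_apply, mul_add]

lemma Nop_smul (γ : ℝ) (c : ℂ) (f : ℂ → ℂ) {z : ℂ} (hz : z ∈ closedBall (0 : ℂ) 1) :
    Nop γ (c • f) z = c * Nop γ f z := by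
  rw [Nop_eq γ _ hz, Nop_eq γ _ hz, ← intervalIntegral.integral_const_mul]
  refine intervalIntegral.integral_congr fun θ _ => ?_
  simp only [slice]
  rw [← intervalIntegral.integral_const_mul]
  simp only [Pi.smul_apply, smul_eq_mul]
  congr 1
  ext u
  ring

lemma Nop_star (γ : ℝ) (f : ℂ → ℂ) {z : ℂ} (hz : z ∈ closedBall (0 : ℂ) 1) :
    Nop γ (star f) z = starRingEnd ℂ (Nop γ f z) := by
  rw [Nop_eq γ _ hz, Nop_eq γ _ hz, ← intervalIntegral.intervalIntegral_conj]
  refine intervalIntegral.integral_congr fun θ _ => ?_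
  simp only [slice]
  rw [← intervalIntegral.intervalIntegral_conj]
  simp

lemma setIntegral_disk_rotate (θ : ℝ) (h : ℂ → ℂ) :
    ∫ z in closedBall (0 : ℂ) 1, h z =
      ∫ z in closedBall (0 : ℂ) 1, h (Complex.exp ((θ : ℂ) * Complex.I) * z) := by
  have hmp : MeasurePreserving (rotation (Circle.exp θ)) (volume : Measure ℂ) volume :=
    (rotation (Circle.exp θ)).measurePreserving
  have h1 := hmp.setIntegral_preimage_emb
    (rotation (Circle.exp θ)).toHomeomorph.measurableEmbedding h (closedBall 0 1)
  rw [← h1, LinearIsometryEquiv.preimage_closedBall]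
  simp [Circle.coe_exp, map_zero]

lemma integral_disk_slice {γ : ℝ} (hγ : -1 < γ) {h : ℂ → ℂ}
    (hh : ContinuousOn h (closedBall 0 1)) :
    ∫ z in closedBall (0 : ℂ) 1, (dwt γ z : ℂ) * h z =
      ∫ x in (-1 : ℝ)..1, (((1 - x ^ 2) ^ (γ + 1 / 2) : ℝ) : ℂ) *
        ∫ u in (-1 : ℝ)..1, (((1 - u ^ 2) ^ γ : ℝ) : ℂ) * h (slicePt 0 x u) := by
  set F : ℂ → ℂ := (closedBall (0 : ℂ) 1).indicator fun z => (dwt γ z : ℂ) * h z with hF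
  have hFi : Integrable F :=
    (integrable_indicator_iff measurableSet_closedBall).2 (integrableOn_dwt_mul hγ hh)
  have hmp := Complex.volume_preserving_equiv_real_prod.symm
  have hFp : Integrable (fun p : ℝ × ℝ => F (Complex.measurableEquivRealProd.symm p)) :=
    (hmp.integrable_comp_emb Complex.measurableEquivRealProd.symm.measurableEmbedding).2 hFi
  rw [← integral_indicator measurableSet_closedBall, ← hF,
    ← hmp.integral_comp Complex.measurableEquivRealProd.symm.measurableEmbedding F,
    Measure.volume_eq_prod, integral_prod_symm _ hFp,
    intervalIntegral.integral_of_le (by norm_num), ← integral_indicator measurableSet_Ioc]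
  refine integral_congr_ae ?_
  have hne : ∀ᵐ x : ℝ, x ∉ ({-1, 1} : Set ℝ) := (Set.toFinite _).countable.ae_notMem _
  filter_upwards [hne] with x hx
  simp only [mem_insert_iff, mem_singleton_iff, not_or] at hx
  have hFz : ∀ y : ℝ, F (Complex.measurableEquivRealProd.symm (y, x)) =
      F ((y : ℂ) + x * Complex.I) := by
    intro y
    congr 1
    apply Complex.ext <;> simp [Complex.measurableEquivRealProd]
  have hmem : ∀ y : ℝ, (y : ℂ) + x * Complex.I ∈ closedBall (0 : ℂ) 1 ↔ y ^ 2 + x ^ 2 ≤ 1 := by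
    intro y
    rw [mem_closedBall_zero_iff, ← Complex.normSq_add_mul_I, Complex.normSq_eq_norm_sq]
    exact (sq_le_one_iff₀ (norm_nonneg _)).symm
  simp only [hFz]
  by_cases hx1 : x ^ 2 < 1
  · have hxabs : |x| ≤ 1 := ((sq_lt_one_iff_abs_lt_one x).1 hx1).le
    have hxm := abs_le.1 hxabs
    rw [indicator_of_mem (show x ∈ Ioc (-1 : ℝ) 1 from
      ⟨lt_of_le_of_ne hxm.1 (Ne.symm hx.1), hxm.2⟩)]
    set c := √(1 - x ^ 2) with hc
    have hc0 : 0 < c := Real.sqrt_pos.2 (by linarith)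
    have hcc : c ^ 2 = 1 - x ^ 2 := Real.sq_sqrt (by linarith)
    have hind : (fun y : ℝ => F ((y : ℂ) + x * Complex.I)) = (Icc (-c) c).indicator
        fun y : ℝ => (dwt γ (y + x * Complex.I) : ℂ) * h (y + x * Complex.I) := by
      ext y
      have : y ∈ Icc (-c) c ↔ y ^ 2 + x ^ 2 ≤ 1 := by
        rw [mem_Icc, ← abs_le, ← sq_le_sq₀ (abs_nonneg y) hc0.le, sq_abs, hcc]
        constructor <;> intro <;> linarith
      simp only [hF, indicator, hmem, this]
    rw [hind, integral_indicator measurableSet_Icc, integral_Icc_eq_integral_Ioc,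
      ← intervalIntegral.integral_of_le (by linarith)]
    have hs := intervalIntegral.smul_integral_comp_mul_left (a := -1) (b := 1)
      (fun y : ℝ => (dwt γ (y + x * Complex.I) : ℂ) * h (y + x * Complex.I)) c
    rw [mul_neg_one, mul_one] at hs
    rw [← hs, Complex.real_smul, ← intervalIntegral.integral_const_mul,
      ← intervalIntegral.integral_const_mul]
    refine intervalIntegral.integral_congr fun u hu => ?_
    rw [uIcc_of_le (by norm_num)] at hu
    have hu2 : 0 ≤ 1 - u ^ 2 := by nlinarith [hu.1, hu.2]
    have hpt : (((c * u : ℝ) : ℂ) + x * Complex.I) = slicePt 0 x u := by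
      simp [slicePt, ← hc]
    have hw : c * dwt γ (slicePt 0 x u) = (1 - x ^ 2) ^ (γ + 1 / 2) * (1 - u ^ 2) ^ γ := by
      rw [dwt, norm_slicePt_sq 0 u hxabs, show 1 - ((1 - x ^ 2) * u ^ 2 + x ^ 2) =
        (1 - x ^ 2) * (1 - u ^ 2) by ring, Real.mul_rpow (by linarith) hu2,
        Real.rpow_add (by linarith), hc, Real.sqrt_eq_rpow]
      ring
    have hw' : (c : ℂ) * (dwt γ (slicePt 0 x u) : ℂ) =
      (((1 - x ^ 2) ^ (γ + 1 / 2) : ℝ) : ℂ) * (((1 - u ^ 2) ^ γ : ℝ) : ℂ) := by exact_mod_cast hw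
    simp only [hpt]
    linear_combination h (slicePt 0 x u) * hw'
  · rw [indicator_of_notMem]
    · refine integral_eq_zero_of_ae (ae_of_all _ fun y => ?_)
      have : ¬ (y ^ 2 + x ^ 2 ≤ 1) := by
        have : x ^ 2 ≠ 1 := fun h => by
          rcases mul_self_eq_one_iff.1 (sq x ▸ h) with h | h <;> simp_all
        have := lt_of_le_of_ne (not_lt.1 hx1) (Ne.symm this)
        nlinarith [sq_nonneg y]
      simp [hF, hmem, this]
    · rintro ⟨h1, h2⟩
      have := lt_of_le_of_ne h2 hx.2
      exact hx1 (by nlinarith)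

lemma lineOffset_rotate (θ : ℝ) (w : ℂ) :
    lineOffset (Complex.exp ((θ : ℂ) * Complex.I) * w) θ = w.im := by
  rw [lineOffset, mul_right_comm, ← Complex.exp_add]
  simp

set_option maxHeartbeats 1000000 in
lemma wip_Nop_eq_of_continuous {γ : ℝ} (hγ : -1 < γ) {f g : ℂ → ℂ} (hf : Continuous f)
    (hg : Continuous g) {M N : ℝ} (hM : ∀ z, ‖f z‖ ≤ M) (hN : ∀ z, ‖g z‖ ≤ N) :
    wip γ (Nop γ f) g = ∫ θ in (0 : ℝ)..(2 * π), ∫ x in (-1 : ℝ)..1,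
      (((1 - x ^ 2) ^ (γ + 1 / 2) : ℝ) : ℂ) * (slice γ f θ x * slice γ g θ x) := by
  have hA := continuous_slice hγ hf hM
  have hAl : Continuous fun p : ℂ × ℝ => slice γ f p.2 (lineOffset p.1 p.2) :=
    hA.comp (continuous_snd.prodMk continuous_lineOffset)
  have h1 : wip γ (Nop γ f) g = ∫ z in closedBall (0 : ℂ) 1, ∫ θ in Ioc (0 : ℝ) (2 * π),
      (dwt γ z : ℂ) * (slice γ f θ (lineOffset z θ) * g z) := by
    refine setIntegral_congr_fun measurableSet_closedBall fun z hz => ?_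
    rw [Nop_eq γ f hz, intervalIntegral.integral_of_le Real.two_pi_pos.le, ← integral_mul_const,
      ← integral_const_mul]
  rw [h1, integral_integral_swap]
  · rw [intervalIntegral.integral_of_le Real.two_pi_pos.le]
    refine integral_congr_ae (ae_of_all _ fun θ => ?_)
    simp only
    rw [setIntegral_disk_rotate θ]
    have hrot : ∀ w, dwt γ (Complex.exp ((θ : ℂ) * Complex.I) * w) = dwt γ w := by
      intro w
      rw [dwt, dwt, norm_mul, Complex.norm_exp_ofReal_mul_I, one_mul]
    simp only [hrot, lineOffset_rotate]
    rw [integral_disk_slice (h := fun w => slice γ f θ w.im *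
      g (Complex.exp ((θ : ℂ) * Complex.I) * w)) hγ]
    · refine intervalIntegral.integral_congr fun x _ => ?_
      have h2 : ∀ u, (slicePt 0 x u).im = x := fun u => by simp [slicePt]
      have h3 : ∀ u, Complex.exp ((θ : ℂ) * Complex.I) * slicePt 0 x u = slicePt θ x u := fun u => by
        simp [slicePt]
      simp only [h2, h3]
      congr 1
      rw [slice.eq_1 γ g, ← intervalIntegral.integral_const_mul]
      congr 1
      ext u
      ring
    · have h4 : Continuous fun w : ℂ => (θ, w.im) := by fun_prop
      have h5 : Continuous fun w : ℂ => slice γ f θ w.im := hA.comp h4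
      have h6 : Continuous fun w : ℂ => g (Complex.exp ((θ : ℂ) * Complex.I) * w) := by fun_prop
      exact (h5.mul h6).continuousOn
  · have hd : Integrable (fun z => (dwt γ z : ℂ)) (volume.restrict (closedBall (0 : ℂ) 1)) :=
      (integrableOn_dwt hγ).ofReal
    have h2 : Integrable (fun p : ℂ × ℝ => (dwt γ p.1 : ℂ))
        ((volume.restrict (closedBall (0 : ℂ) 1)).prod (volume.restrict (Ioc (0 : ℝ) (2 * π)))) :=
      hd.comp_fst _
    have h3 : ∀ᵐ p : ℂ × ℝ ∂((volume.restrict (closedBall (0 : ℂ) 1)).prod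
        (volume.restrict (Ioc (0 : ℝ) (2 * π)))),
        ‖slice γ f p.2 (lineOffset p.1 p.2) * g p.1‖ ≤ wmass γ * M * N := by
      rw [Measure.prod_restrict]
      refine (ae_restrict_iff' (measurableSet_closedBall.prod measurableSet_Ioc)).2
        (ae_of_all _ fun p hp => ?_)
      rw [norm_mul]
      have h4 := norm_slice_le (x := lineOffset p.1 p.2) (θ := p.2) hγ (fun z _ => hM z)
        (abs_lineOffset_le hp.1 p.2)
      exact mul_le_mul h4 (hN _) (norm_nonneg _) ((norm_nonneg _).trans h4)
    have h5 : AEStronglyMeasurable (fun p : ℂ × ℝ => slice γ f p.2 (lineOffset p.1 p.2) * g p.1)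
        ((volume.restrict (closedBall (0 : ℂ) 1)).prod (volume.restrict (Ioc (0 : ℝ) (2 * π)))) :=
      (hAl.mul (hg.comp continuous_fst)).aestronglyMeasurable
    exact Integrable.mul_bdd (c := wmass γ * M * N) h2 h5 h3

lemma wip_Nop_symm {γ : ℝ} (hγ : -1 < γ) {f g : ℂ → ℂ} (hf : ContinuousOn f (closedBall 0 1))
    (hg : ContinuousOn g (closedBall 0 1)) : wip γ (Nop γ f) g = wip γ f (Nop γ g) := by
  obtain ⟨M, hM⟩ := exists_bound_radExt hf
  obtain ⟨N, hN⟩ := exists_bound_radExt hg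
  rw [wip_comm γ f, wip_congr (Nop_congr (radExt_eqOn f).symm) (radExt_eqOn g).symm,
    wip_congr (Nop_congr (radExt_eqOn g).symm) (radExt_eqOn f).symm,
    wip_Nop_eq_of_continuous hγ (continuous_radExt hf) (continuous_radExt hg) hM hN,
    wip_Nop_eq_of_continuous hγ (continuous_radExt hg) (continuous_radExt hf) hN hM]
  simp only [mul_comm (slice γ (radExt f) _ _)]

/-- `P` has degree at most `n`, with coefficient `c` in degree `n`. -/
def HasTop (P : Polynomial ℂ) (n : ℕ) (c : ℂ) : Prop := P.natDegree ≤ n ∧ P.coeff n = c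

lemma HasTop.mul {P Q : Polynomial ℂ} {n m : ℕ} {c d : ℂ} (hP : HasTop P n c) (hQ : HasTop Q m d) :
    HasTop (P * Q) (n + m) (c * d) :=
  ⟨Polynomial.natDegree_mul_le_of_le hP.1 hQ.1, by
    rw [Polynomial.coeff_mul_add_eq_of_natDegree_le hP.1 hQ.1, hP.2, hQ.2]⟩

lemma HasTop.pow {P : Polynomial ℂ} {n : ℕ} {c : ℂ} (hP : HasTop P n c) (k : ℕ) :
    HasTop (P ^ k) (k * n) (c ^ k) :=
  ⟨Polynomial.natDegree_pow_le_of_le k hP.1, by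
    rw [Polynomial.coeff_pow_of_natDegree_le hP.1, hP.2]⟩

lemma hasTop_zero (n : ℕ) : HasTop 0 n 0 := by simp [HasTop]

lemma HasTop.sum {ι : Type*} {s : Finset ι} {P : ι → Polynomial ℂ} {n : ℕ} {c : ι → ℂ}
    (h : ∀ i ∈ s, HasTop (P i) n (c i)) : HasTop (∑ i ∈ s, P i) n (∑ i ∈ s, c i) :=
  ⟨Polynomial.natDegree_sum_le_of_forall_le _ _ fun i hi => (h i hi).1, by
    rw [Polynomial.finsetSum_coeff]
    exact Finset.sum_congr rfl fun i hi => (h i hi).2⟩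

lemma HasTop.C_mul {P : Polynomial ℂ} {n : ℕ} {c : ℂ} (d : ℂ) (hP : HasTop P n c) :
    HasTop (Polynomial.C d * P) n (d * c) :=
  ⟨(Polynomial.natDegree_C_mul_le _ _).trans hP.1, by rw [Polynomial.coeff_C_mul, hP.2]⟩

lemma hasTop_linear (c : ℂ) : HasTop (Polynomial.C c * Polynomial.X) 1 c :=
  ⟨by compute_degree, by simp⟩

lemma hasTop_one_sub_sq : HasTop (1 - Polynomial.X ^ 2 : Polynomial ℂ) 2 (-1) :=
  ⟨by compute_degree, by simp [Polynomial.coeff_one]⟩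

/-- Moments of the weight `(1-u²)^γ`. -/
def wmom (γ : ℝ) (k : ℕ) : ℂ := ∫ u in (-1 : ℝ)..1, (((1 - u ^ 2) ^ γ : ℝ) : ℂ) * (u : ℂ) ^ k

lemma wmom_odd (γ : ℝ) {k : ℕ} (hk : Odd k) : wmom γ k = 0 := by
  have h := intervalIntegral.integral_comp_neg (a := -1) (b := 1)
    (fun u : ℝ => (((1 - u ^ 2) ^ γ : ℝ) : ℂ) * (u : ℂ) ^ k)
  simp only [neg_neg, neg_sq, ofReal_neg, hk.neg_pow, mul_neg] at h
  rw [intervalIntegral.integral_neg] at h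
  exact self_eq_neg.1 h.symm

lemma intervalIntegrable_weight_mul {γ : ℝ} (hγ : -1 < γ) {f : ℝ → ℂ} (hf : Continuous f) :
    IntervalIntegrable (fun u : ℝ => (((1 - u ^ 2) ^ γ : ℝ) : ℂ) * f u) volume (-1) 1 :=
  IntervalIntegrable.mul_continuousOn (f := fun u : ℝ => (((1 - u ^ 2) ^ γ : ℝ) : ℂ))
    ⟨(intervalIntegrable_weight hγ).1.ofReal, (intervalIntegrable_weight hγ).2.ofReal⟩ hf.continuousOn

/-- Integration of a product of binomial powers against the weight. -/
lemma integral_weight_binomial {γ : ℝ} (hγ : -1 < γ) (a b : ℕ) (c p q : ℂ) :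
    ∫ u in (-1 : ℝ)..1, (((1 - u ^ 2) ^ γ : ℝ) : ℂ) * ((c * u + p) ^ a * (c * u + q) ^ b) =
      ∑ i ∈ Finset.range (a + 1), ∑ j ∈ Finset.range (b + 1),
        (a.choose i * b.choose j * wmom γ (i + j)) * (c ^ (i + j) * (p ^ (a - i) * q ^ (b - j))) := by
  have h : ∀ u : ℝ, (((1 - u ^ 2) ^ γ : ℝ) : ℂ) * ((c * u + p) ^ a * (c * u + q) ^ b) =
      ∑ i ∈ Finset.range (a + 1), ∑ j ∈ Finset.range (b + 1),
        ((((1 - u ^ 2) ^ γ : ℝ) : ℂ) * (u : ℂ) ^ (i + j)) *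
          ((a.choose i * b.choose j) * (c ^ (i + j) * (p ^ (a - i) * q ^ (b - j)))) := by
    intro u
    rw [add_pow, add_pow, Finset.sum_mul_sum, Finset.mul_sum]
    refine Finset.sum_congr rfl fun i _ => ?_
    rw [Finset.mul_sum]
    refine Finset.sum_congr rfl fun j _ => ?_
    ring
  simp only [h]
  have hi : ∀ k : ℕ, IntervalIntegrable
      (fun u : ℝ => (((1 - u ^ 2) ^ γ : ℝ) : ℂ) * (u : ℂ) ^ k) volume (-1) 1 := fun k =>
    intervalIntegrable_weight_mul hγ (f := fun u : ℝ => (u : ℂ) ^ k) (by fun_prop)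
  rw [intervalIntegral.integral_finsetSum]
  · refine Finset.sum_congr rfl fun i _ => ?_
    rw [intervalIntegral.integral_finsetSum]
    · refine Finset.sum_congr rfl fun j _ => ?_
      rw [intervalIntegral.integral_mul_const, wmom]
      ring
    · exact fun j _ => (hi _).mul_const _
  · intro i _
    have := IntervalIntegrable.sum (Finset.range (b + 1)) fun j _ => (hi (i + j)).mul_const
      ((a.choose i * b.choose j) * (c ^ (i + j) * (p ^ (a - i) * q ^ (b - j))))
    simpa [Finset.sum_fn] using this

lemma exists_slice_zmono {γ : ℝ} (hγ : -1 < γ) (a b : ℕ) : ∃ P : Polynomial ℂ,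
    HasTop P (a + b) (Complex.I ^ (a + b) * ∫ u in (-1 : ℝ)..1, (((1 - u ^ 2) ^ γ : ℝ) : ℂ) *
      (((1 : ℂ) * u + 1) ^ a * ((1 : ℂ) * u + (-1)) ^ b)) ∧
    ∀ θ x : ℝ, |x| ≤ 1 → slice γ (zmono a b) θ x =
      Complex.exp ((θ : ℂ) * Complex.I) ^ a * Complex.exp (-(θ : ℂ) * Complex.I) ^ b *
        P.eval (x : ℂ) := by
  refine ⟨∑ i ∈ Finset.range (a + 1), ∑ j ∈ Finset.range (b + 1),
    Polynomial.C (a.choose i * b.choose j * wmom γ (i + j)) *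
      ((1 - Polynomial.X ^ 2) ^ ((i + j) / 2) * ((Polynomial.C Complex.I * Polynomial.X) ^ (a - i) *
        (Polynomial.C (-Complex.I) * Polynomial.X) ^ (b - j))), ?_, fun θ x hx => ?_⟩
  · rw [integral_weight_binomial hγ, Finset.mul_sum]
    refine HasTop.sum fun i hi => ?_
    rw [Finset.mul_sum]
    refine HasTop.sum fun j hj => ?_
    have hi' : i ≤ a := Nat.lt_succ_iff.1 (Finset.mem_range.1 hi)
    have hj' : j ≤ b := Nat.lt_succ_iff.1 (Finset.mem_range.1 hj)
    rcases Nat.even_or_odd (i + j) with he | ho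
    · obtain ⟨m, hm⟩ := he
      have h2 : (i + j) / 2 = m := by omega
      rw [h2]
      have h3 := ((hasTop_one_sub_sq.pow m).mul (((hasTop_linear Complex.I).pow (a - i)).mul
        ((hasTop_linear (-Complex.I)).pow (b - j)))).C_mul
          (a.choose i * b.choose j * wmom γ (i + j))
      rw [show m * 2 + ((a - i) * 1 + (b - j) * 1) = a + b by omega] at h3
      convert! h3 using 1
      rw [show a + b = m * 2 + ((a - i) + (b - j)) by omega, pow_add, pow_add, pow_mul', Complex.I_sq,
        neg_pow Complex.I]
      simp only [one_pow]
      ring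
    · rw [wmom_odd γ ho]
      simpa using hasTop_zero _
  · have hx2 : 0 ≤ 1 - x ^ 2 := by nlinarith [abs_le.1 hx]
    have h1 : slice γ (zmono a b) θ x = Complex.exp ((θ : ℂ) * Complex.I) ^ a *
        Complex.exp (-(θ : ℂ) * Complex.I) ^ b * ∫ u in (-1 : ℝ)..1,
        (((1 - u ^ 2) ^ γ : ℝ) : ℂ) * (((√(1 - x ^ 2) : ℂ) * u + x * Complex.I) ^ a *
          ((√(1 - x ^ 2) : ℂ) * u + -(x * Complex.I)) ^ b) := by
      rw [slice, ← intervalIntegral.integral_const_mul]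
      congr 1
      ext u
      rw [zmono, slicePt, map_mul, ← Complex.exp_conj]
      simp only [map_mul, map_add, Complex.conj_ofReal, Complex.conj_I, mul_pow]
      push_cast
      ring_nf
    rw [h1, integral_weight_binomial hγ]
    congr 1
    simp only [Polynomial.eval_finsetSum, Polynomial.eval_mul, Polynomial.eval_C,
      Polynomial.eval_pow, Polynomial.eval_sub, Polynomial.eval_one, Polynomial.eval_X]
    refine Finset.sum_congr rfl fun i _ => Finset.sum_congr rfl fun j _ => ?_
    rcases Nat.even_or_odd (i + j) with he | ho
    · obtain ⟨m, hm⟩ := he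
      have h2 : (i + j) / 2 = m := by omega
      have h3 : (√(1 - x ^ 2) : ℂ) ^ (i + j) = (1 - (x : ℂ) ^ 2) ^ m := by
        rw [hm, ← two_mul, pow_mul, ← Complex.ofReal_pow, Real.sq_sqrt hx2]
        push_cast
        rfl
      rw [h2, h3]
      ring
    · rw [wmom_odd γ ho]
      simp

lemma integral_exp_pow (m n : ℕ) : ∫ θ in (0 : ℝ)..(2 * π),
    Complex.exp ((θ : ℂ) * Complex.I) ^ m * Complex.exp (-(θ : ℂ) * Complex.I) ^ n =
      if m = n then (2 * π : ℂ) else 0 := by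
  have h : ∀ θ : ℝ, Complex.exp ((θ : ℂ) * Complex.I) ^ m *
      Complex.exp (-(θ : ℂ) * Complex.I) ^ n = Complex.exp ((((m : ℂ) - n) * Complex.I) * θ) := by
    intro θ
    rw [← Complex.exp_nat_mul, ← Complex.exp_nat_mul, ← Complex.exp_add]
    ring_nf
  simp only [h]
  split_ifs with hmn
  · simp [hmn]
  · have h0 : (m : ℂ) - n ≠ 0 := sub_ne_zero.2 (by exact_mod_cast hmn)
    rw [integral_exp_mul_complex (mul_ne_zero h0 Complex.I_ne_zero)]
    have : Complex.exp ((((m : ℂ) - n) * Complex.I) * ((2 * π : ℝ) : ℂ)) = 1 :=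
      Complex.exp_eq_one_iff.2 ⟨(m : ℤ) - n, by push_cast; ring⟩
    rw [this]
    simp

lemma lineOffset_eq (z : ℂ) (θ : ℝ) : (lineOffset z θ : ℂ) = (2 * Complex.I)⁻¹ *
    (z * Complex.exp (-(θ : ℂ) * Complex.I) +
      -(starRingEnd ℂ z * Complex.exp ((θ : ℂ) * Complex.I))) := by
  rw [lineOffset, Complex.im_eq_sub_conj, map_mul, ← Complex.exp_conj]
  simp only [map_mul, map_neg, Complex.conj_ofReal, Complex.conj_I, neg_mul, mul_neg, neg_neg]
  field_simp
  ring

lemma integral_exp_lineOffset (a b k : ℕ) (z : ℂ) : ∫ θ in (0 : ℝ)..(2 * π),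
    Complex.exp ((θ : ℂ) * Complex.I) ^ a * Complex.exp (-(θ : ℂ) * Complex.I) ^ b *
      (lineOffset z θ : ℂ) ^ k = ∑ l ∈ Finset.range (k + 1),
        ((2 * Complex.I)⁻¹ ^ k * k.choose l * (-1) ^ (k - l) *
          (if a + (k - l) = b + l then (2 * π : ℂ) else 0)) * zmono l (k - l) z := by
  have h : ∀ θ : ℝ, Complex.exp ((θ : ℂ) * Complex.I) ^ a *
      Complex.exp (-(θ : ℂ) * Complex.I) ^ b * (lineOffset z θ : ℂ) ^ k =
      ∑ l ∈ Finset.range (k + 1), (((2 * Complex.I)⁻¹ ^ k * k.choose l * (-1) ^ (k - l)) *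
        zmono l (k - l) z) * (Complex.exp ((θ : ℂ) * Complex.I) ^ (a + (k - l)) *
          Complex.exp (-(θ : ℂ) * Complex.I) ^ (b + l)) := by
    intro θ
    rw [lineOffset_eq, mul_pow, add_pow, Finset.mul_sum, Finset.mul_sum]
    refine Finset.sum_congr rfl fun l _ => ?_
    rw [zmono, neg_pow, mul_pow, mul_pow]
    ring
  simp only [h]
  rw [intervalIntegral.integral_finsetSum]
  · refine Finset.sum_congr rfl fun l _ => ?_
    rw [intervalIntegral.integral_const_mul, integral_exp_pow]
    ring
  · intro l _
    apply Continuous.intervalIntegrable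
    fun_prop

/-- Diagonal entries of the normal operator in the basis of monomials. -/
def nopEig (γ : ℝ) (a b : ℕ) : ℝ :=
  2 * π / 2 ^ (a + b) * (a + b).choose a *
    ∫ u in (-1 : ℝ)..1, (1 - u ^ 2) ^ γ * ((1 + u) ^ a * (1 - u) ^ b)

lemma Nop_zmono {γ : ℝ} (hγ : -1 < γ) (a b : ℕ) : ∃ r ∈ zPoly (a + b),
    ∀ z ∈ closedBall (0 : ℂ) 1, Nop γ (zmono a b) z = nopEig γ a b * zmono a b z + r z := by
  obtain ⟨P, ⟨hPd, hPc⟩, hP⟩ := exists_slice_zmono hγ a b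
  have hJ : ∀ k, (fun z => ∫ θ in (0 : ℝ)..(2 * π), Complex.exp ((θ : ℂ) * Complex.I) ^ a *
      Complex.exp (-(θ : ℂ) * Complex.I) ^ b * (lineOffset z θ : ℂ) ^ k) ∈ zPoly (k + 1) := by
    intro k
    have : (fun z => ∫ θ in (0 : ℝ)..(2 * π), Complex.exp ((θ : ℂ) * Complex.I) ^ a *
      Complex.exp (-(θ : ℂ) * Complex.I) ^ b * (lineOffset z θ : ℂ) ^ k) =
      ∑ l ∈ Finset.range (k + 1), ((2 * Complex.I)⁻¹ ^ k * k.choose l * (-1) ^ (k - l) *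
          (if a + (k - l) = b + l then (2 * π : ℂ) else 0)) • zmono l (k - l) := by
      ext z
      rw [integral_exp_lineOffset]
      simp only [Finset.sum_apply, Pi.smul_apply, smul_eq_mul]
    rw [this]
    refine Submodule.sum_mem _ fun l hl => Submodule.smul_mem _ _ (zmono_mem_zPoly ?_)
    have := Finset.mem_range.1 hl
    omega
  refine ⟨∑ k ∈ Finset.range (a + b), P.coeff k • fun z => ∫ θ in (0 : ℝ)..(2 * π),
    Complex.exp ((θ : ℂ) * Complex.I) ^ a * Complex.exp (-(θ : ℂ) * Complex.I) ^ b *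
      (lineOffset z θ : ℂ) ^ k, ?_, fun z hz => ?_⟩
  · refine Submodule.sum_mem _ fun k hk => Submodule.smul_mem _ _ (zPoly_mono ?_ (hJ k))
    exact Finset.mem_range.1 hk
  · have h1 : Nop γ (zmono a b) z = ∑ k ∈ Finset.range (a + b + 1), P.coeff k *
        ∫ θ in (0 : ℝ)..(2 * π), Complex.exp ((θ : ℂ) * Complex.I) ^ a *
          Complex.exp (-(θ : ℂ) * Complex.I) ^ b * (lineOffset z θ : ℂ) ^ k := by
      rw [Nop_eq γ _ hz]
      have : ∀ θ : ℝ, slice γ (zmono a b) θ (lineOffset z θ) = ∑ k ∈ Finset.range (a + b + 1),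
          P.coeff k * (Complex.exp ((θ : ℂ) * Complex.I) ^ a *
          Complex.exp (-(θ : ℂ) * Complex.I) ^ b * (lineOffset z θ : ℂ) ^ k) := by
        intro θ
        rw [hP θ _ (abs_lineOffset_le hz θ),
          Polynomial.eval_eq_sum_range' (Nat.lt_succ_iff.2 hPd), Finset.mul_sum]
        refine Finset.sum_congr rfl fun k _ => ?_
        ring
      simp only [this]
      rw [intervalIntegral.integral_finsetSum]
      · simp only [intervalIntegral.integral_const_mul]
      · intro k _
        apply Continuous.intervalIntegrable
        unfold lineOffset
        fun_prop
    rw [h1, Finset.sum_range_succ, add_comm, hPc]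
    congr 1
    · rw [integral_exp_lineOffset, Finset.sum_eq_single a]
      · have h2 : a + b - a = b := by omega
        rw [if_pos (by omega), h2, ← mul_assoc]
        congr 1
        have h3 : (∫ u in (-1 : ℝ)..1, (((1 - u ^ 2) ^ γ : ℝ) : ℂ) *
            (((1 : ℂ) * u + 1) ^ a * ((1 : ℂ) * u + (-1)) ^ b)) = (-1) ^ b *
            ((∫ u in (-1 : ℝ)..1, (1 - u ^ 2) ^ γ * ((1 + u) ^ a * (1 - u) ^ b) : ℝ) : ℂ) := by
          rw [← intervalIntegral.integral_ofReal, ← intervalIntegral.integral_const_mul]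
          congr 1
          ext u
          have : ((1 : ℂ) * u + (-1)) ^ b = (-1) ^ b * (1 - (u : ℂ)) ^ b := by
            rw [← mul_pow]; ring
          rw [this]
          push_cast
          ring
        rw [h3, nopEig]
        have h4 : ((-1 : ℂ)) ^ b * (-1) ^ b = 1 := by rw [← mul_pow]; simp
        have h5 : Complex.I ^ (a + b) * (2 * Complex.I)⁻¹ ^ (a + b) = 1 / 2 ^ (a + b) := by
          rw [← mul_pow, ← one_div_pow]
          congr 1
          field_simp
        push_cast
        linear_combination (2 * π * ((a + b).choose a : ℂ) *
          ((∫ u in (-1 : ℝ)..1, (1 - u ^ 2) ^ γ * ((1 + u) ^ a * (1 - u) ^ b) : ℝ) : ℂ)) *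
          (Complex.I ^ (a + b) * (2 * Complex.I)⁻¹ ^ (a + b) * h4 + h5)
      · intro l hl hla
        have := Finset.mem_range.1 hl
        rw [if_neg (by omega)]
        simp
      · intro h
        exact absurd (Finset.mem_range.2 (by omega)) h
    · simp

lemma integral_one_add_pow_mul_one_sub_pow (q : ℕ) : ∀ p : ℕ,
    (∫ u in (-1 : ℝ)..1, (1 + u) ^ p * (1 - u) ^ q) * (p + q + 1).factorial =
      2 ^ (p + q + 1) * (p.factorial * q.factorial) := by
  induction q with
  | zero =>
    intro p
    have h : ∫ u in (-1 : ℝ)..1, ((1 + u) ^ p * (1 - u) ^ 0 : ℝ) = 2 ^ (p + 1) / (p + 1) := by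
      simp only [pow_zero, mul_one]
      rw [intervalIntegral.integral_comp_add_left (fun u : ℝ => u ^ p), integral_pow]
      norm_num
    rw [h, add_zero, Nat.factorial_succ]
    push_cast
    field_simp
    simp
  | succ q ih =>
    intro p
    have hd : ∀ u : ℝ, HasDerivAt (fun u : ℝ => (1 + u) ^ (p + 1) * (1 - u) ^ (q + 1))
        ((p + 1) * ((1 + u) ^ p * (1 - u) ^ (q + 1)) -
          (q + 1) * ((1 + u) ^ (p + 1) * (1 - u) ^ q)) u := by
      intro u
      have h1 := ((hasDerivAt_id u).const_add (1 : ℝ)).pow (p + 1)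
      have h2 := ((hasDerivAt_id u).const_sub (1 : ℝ)).pow (q + 1)
      convert! h1.mul h2 using 1
      simp
      ring
    have h0 := intervalIntegral.integral_eq_sub_of_hasDerivAt (a := -1) (b := 1)
      (fun u _ => hd u) (by apply Continuous.intervalIntegrable; fun_prop)
    rw [intervalIntegral.integral_sub (by apply Continuous.intervalIntegrable; fun_prop)
      (by apply Continuous.intervalIntegrable; fun_prop), intervalIntegral.integral_const_mul,
      intervalIntegral.integral_const_mul] at h0
    norm_num at h0
    have h1 := ih (p + 1)
    rw [show p + 1 + q + 1 = p + (q + 1) + 1 by ring] at h1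
    rw [Nat.factorial_succ p] at h1
    rw [Nat.factorial_succ q]
    push_cast at h1 ⊢
    have hp : (p : ℝ) + 1 ≠ 0 := by positivity
    refine mul_left_cancel₀ hp ?_
    linear_combination ((p + (q + 1) + 1).factorial : ℝ) * h0 + ((q : ℝ) + 1) * h1

lemma le_nopEig {γ : ℝ} (hγ : -1 < γ) {N : ℕ} (hN : γ ≤ N) (a b : ℕ) :
    2 * π / ((2 * N + 1) * ((a + b : ℕ) + 1)) ^ (2 * N + 1) ≤ nopEig γ a b := by
  set n := a + b with hn
  have hmono : ∫ u in (-1 : ℝ)..1, (1 + u) ^ (a + N) * (1 - u) ^ (b + N) ≤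
      ∫ u in (-1 : ℝ)..1, (1 - u ^ 2) ^ γ * ((1 + u) ^ a * (1 - u) ^ b) := by
    refine intervalIntegral.integral_mono_on_of_le_Ioo (by norm_num)
      (by apply Continuous.intervalIntegrable; fun_prop)
      ((intervalIntegrable_weight hγ).mul_continuousOn (by fun_prop)) fun u hu => ?_
    have h1 : 0 < 1 - u ^ 2 := by nlinarith [hu.1, hu.2]
    have h2 : (1 + u) ^ (a + N) * (1 - u) ^ (b + N) =
        (1 - u ^ 2) ^ N * ((1 + u) ^ a * (1 - u) ^ b) := by
      rw [show 1 - u ^ 2 = (1 + u) * (1 - u) by ring, mul_pow]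
      ring
    rw [h2]
    have h3 : 0 ≤ 1 + u := by linarith [hu.1]
    have h4 : 0 ≤ 1 - u := by linarith [hu.2]
    gcongr
    rw [← Real.rpow_natCast]
    exact Real.rpow_le_rpow_of_exponent_ge h1 (by nlinarith [sq_nonneg u]) hN
  have hB := integral_one_add_pow_mul_one_sub_pow (b + N) (a + N)
  rw [show a + N + (b + N) + 1 = n + (2 * N + 1) by omega] at hB
  set B := ∫ u in (-1 : ℝ)..1, (1 + u) ^ (a + N) * (1 - u) ^ (b + N)
  have hfac : ((n + (2 * N + 1)).factorial : ℝ) ≤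
      n.factorial * ((2 * N + 1) * ((n : ℝ) + 1)) ^ (2 * N + 1) := by
    rw [← Nat.factorial_mul_ascFactorial]
    push_cast
    gcongr
    have := Nat.ascFactorial_le_pow_add n (2 * N + 1)
    calc (((n + 1).ascFactorial (2 * N + 1) : ℕ) : ℝ) ≤ ((n + (2 * N + 1)) ^ (2 * N + 1) : ℕ) := by
          exact_mod_cast this
      _ ≤ _ := by
          push_cast
          gcongr
          nlinarith [(Nat.cast_nonneg n : (0 : ℝ) ≤ n), (Nat.cast_nonneg N : (0 : ℝ) ≤ N),
            mul_nonneg (Nat.cast_nonneg n : (0 : ℝ) ≤ n) (Nat.cast_nonneg N : (0 : ℝ) ≤ N)]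
  have hchoose : ((n.choose a : ℕ) : ℝ) * (a.factorial * b.factorial) = n.factorial := by
    have := Nat.choose_mul_factorial_mul_factorial (n := n) (k := a) (by omega)
    rw [show n - a = b by omega, mul_assoc] at this
    exact_mod_cast this
  have hB2 : (2 : ℝ) ^ n * (a.factorial * b.factorial) ≤ B * (n + (2 * N + 1)).factorial := by
    rw [hB]
    gcongr <;> norm_num
  unfold nopEig
  rw [← hn]
  have hP : (0 : ℝ) < ((2 * N + 1) * ((n : ℝ) + 1)) ^ (2 * N + 1) := by positivity
  have hBnn : 0 ≤ B := by
    by_contra hneg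
    have : B * (n + (2 * N + 1)).factorial < 0 :=
      mul_neg_of_neg_of_pos (not_le.1 hneg) (by positivity)
    have : (0 : ℝ) < 2 ^ n * (a.factorial * b.factorial) := by positivity
    linarith
  have key : 1 ≤ (1 / 2 ^ n * n.choose a * B) * ((2 * N + 1) * ((n : ℝ) + 1)) ^ (2 * N + 1) := by
    have h1 : (2 : ℝ) ^ n * n.factorial ≤ n.choose a * B *
        (n.factorial * ((2 * N + 1) * ((n : ℝ) + 1)) ^ (2 * N + 1)) := by
      calc (2 : ℝ) ^ n * n.factorial = n.choose a * (2 ^ n * (a.factorial * b.factorial)) := by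
            rw [← hchoose]; ring
        _ ≤ n.choose a * (B * (n + (2 * N + 1)).factorial) := by gcongr
        _ ≤ n.choose a * (B * (n.factorial * ((2 * N + 1) * ((n : ℝ) + 1)) ^ (2 * N + 1))) := by
            gcongr
        _ = _ := by ring
    have h2 : (0 : ℝ) < 2 ^ n * n.factorial := by positivity
    refine le_of_mul_le_mul_left ?_ h2
    calc _ = (2 : ℝ) ^ n * n.factorial := mul_one _
      _ ≤ _ := h1
      _ = _ := by field_simp
  calc 2 * π / ((2 * N + 1) * ((n : ℝ) + 1)) ^ (2 * N + 1)
      ≤ 2 * π * (1 / 2 ^ n * n.choose a * B) := by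
        rw [div_le_iff₀ hP, mul_assoc]
        exact le_mul_of_one_le_right (by positivity) key
    _ ≤ 2 * π * (1 / 2 ^ n * n.choose a *
        ∫ u in (-1 : ℝ)..1, (1 - u ^ 2) ^ γ * ((1 + u) ^ a * (1 - u) ^ b)) := by gcongr
    _ = _ := by ring

lemma exists_zPoly_Nop {γ : ℝ} (hγ : -1 < γ) {n : ℕ} {p : ℂ → ℂ} (hp : p ∈ zPoly n) :
    ∃ q ∈ zPoly n, EqOn (Nop γ p) q (closedBall 0 1) := by
  induction hp using Submodule.span_induction with
  | mem x hx =>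
    obtain ⟨a, b, hab, rfl⟩ := hx
    obtain ⟨r, hr, h⟩ := Nop_zmono hγ a b
    exact ⟨(nopEig γ a b : ℂ) • zmono a b + r, add_mem (Submodule.smul_mem _ _ (zmono_mem_zPoly hab))
      (zPoly_mono hab.le hr), fun z hz => h z hz⟩
  | zero =>
    refine ⟨0, zero_mem _, fun z hz => ?_⟩
    have := Nop_smul γ 0 0 hz
    simpa using this
  | add x y hx hy h1 h2 =>
    obtain ⟨q, hq, hq'⟩ := h1
    obtain ⟨r, hr, hr'⟩ := h2
    refine ⟨q + r, add_mem hq hr, fun z hz => ?_⟩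
    rw [Nop_add hγ (continuous_of_mem_zPoly hx).continuousOn (continuous_of_mem_zPoly hy).continuousOn
      hz, hq' hz, hr' hz, Pi.add_apply]
  | smul c x hx h =>
    obtain ⟨q, hq, hq'⟩ := h
    refine ⟨c • q, Submodule.smul_mem _ _ hq, fun z hz => ?_⟩
    rw [Nop_smul γ c _ hz, hq' hz, Pi.smul_apply, smul_eq_mul]

lemma eq_of_mem_zPoly_of_eqOn {n : ℕ} {p q : ℂ → ℂ} (hp : p ∈ zPoly n) (hq : q ∈ zPoly n)
    (h : EqOn p q (closedBall 0 1)) : p = q :=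
  sub_eq_zero.1 <| eq_zero_of_eqOn_closedBall (sub_mem hp hq) fun z hz => by
    simp [h hz]

/-- The normal operator on polynomials of degree less than `n`. -/
def nopLin {γ : ℝ} (hγ : -1 < γ) (n : ℕ) : zPoly n →ₗ[ℂ] zPoly n where
  toFun p := ⟨(exists_zPoly_Nop hγ p.2).choose, (exists_zPoly_Nop hγ p.2).choose_spec.1⟩
  map_add' p q := by
    refine Subtype.ext (eq_of_mem_zPoly_of_eqOn (Subtype.prop _) (Subtype.prop _) fun z hz => ?_)
    have h := (exists_zPoly_Nop hγ (p + q).2).choose_spec.2 hz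
    exact h.symm.trans ((Nop_add hγ (continuous_of_mem_zPoly p.2).continuousOn
      (continuous_of_mem_zPoly q.2).continuousOn hz).trans
      (congrArg₂ (· + ·) ((exists_zPoly_Nop hγ p.2).choose_spec.2 hz)
        ((exists_zPoly_Nop hγ q.2).choose_spec.2 hz)))
  map_smul' c p := by
    refine Subtype.ext (eq_of_mem_zPoly_of_eqOn (Subtype.prop _) (Subtype.prop _) fun z hz => ?_)
    have h := (exists_zPoly_Nop hγ (c • p).2).choose_spec.2 hz
    exact h.symm.trans ((Nop_smul γ c _ hz).trans
      (congrArg (c * ·) ((exists_zPoly_Nop hγ p.2).choose_spec.2 hz)))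

lemma nopLin_eqOn {γ : ℝ} (hγ : -1 < γ) {n : ℕ} (p : zPoly n) :
    EqOn (Nop γ p) (nopLin hγ n p) (closedBall 0 1) :=
  (exists_zPoly_Nop hγ p.2).choose_spec.2

lemma exists_Nop_sub_mul_eq {γ : ℝ} (hγ : -1 < γ) {n : ℕ} {μ : ℝ}
    (hμ : ∀ a b, a + b < n → μ < nopEig γ a b) {q : ℂ → ℂ} (hq : q ∈ zPoly n) :
    ∃ p ∈ zPoly n, ∀ z ∈ closedBall (0 : ℂ) 1, Nop γ p z - μ * p z = q z := by
  induction n generalizing q with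
  | zero =>
    rw [zPoly_zero_eq_zero hq]
    refine ⟨0, zero_mem _, fun z hz => ?_⟩
    simpa using Nop_smul γ 0 0 hz
  | succ k ih =>
    induction hq using Submodule.span_induction with
    | mem x hx =>
      obtain ⟨a, b, hab, rfl⟩ := hx
      obtain ⟨r, hr, h⟩ := Nop_zmono hγ a b
      obtain ⟨p, hp, hp'⟩ := ih (fun a b h => hμ a b (h.trans k.lt_succ_self))
        (zPoly_mono (Nat.lt_succ_iff.1 hab) hr)
      have h0 : (nopEig γ a b : ℂ) - μ ≠ 0 := by
        exact_mod_cast (sub_pos.2 (hμ a b hab)).ne'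
      have hm := zmono_mem_zPoly hab
      refine ⟨((nopEig γ a b : ℂ) - μ)⁻¹ • (zmono a b + (-1 : ℂ) • p), Submodule.smul_mem _ _
        (add_mem hm (Submodule.smul_mem _ _ (zPoly_mono k.le_succ hp))), fun z hz => ?_⟩
      rw [Nop_smul γ _ _ hz, Nop_add hγ (continuous_of_mem_zPoly hm).continuousOn
        (continuous_of_mem_zPoly (Submodule.smul_mem _ _ hp)).continuousOn hz, Nop_smul γ _ _ hz,
        h z hz]
      simp only [Pi.smul_apply, Pi.add_apply, smul_eq_mul]
      field_simp
      linear_combination -hp' z hz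
    | zero =>
      refine ⟨0, zero_mem _, fun z hz => ?_⟩
      simpa using Nop_smul γ 0 0 hz
    | add x y hx hy h1 h2 =>
      obtain ⟨q, hq, hq'⟩ := h1
      obtain ⟨r, hr, hr'⟩ := h2
      refine ⟨q + r, add_mem hq hr, fun z hz => ?_⟩
      rw [Nop_add hγ (continuous_of_mem_zPoly hq).continuousOn
        (continuous_of_mem_zPoly hr).continuousOn hz, Pi.add_apply, Pi.add_apply]
      linear_combination hq' z hz + hr' z hz
    | smul c x hx h =>
      obtain ⟨q, hq, hq'⟩ := h
      refine ⟨c • q, Submodule.smul_mem _ _ hq, fun z hz => ?_⟩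
      rw [Nop_smul γ c _ hz, Pi.smul_apply, Pi.smul_apply, smul_eq_mul, smul_eq_mul]
      linear_combination c * hq' z hz

lemma nopLin_eq_smul {γ : ℝ} (hγ : -1 < γ) {n : ℕ} {μ : ℝ}
    (hμ : ∀ a b, a + b < n → μ < nopEig γ a b) {p : zPoly n} (hp : nopLin hγ n p = (μ : ℂ) • p) :
    p = 0 := by
  have hsurj : Function.Surjective (nopLin hγ n - (μ : ℂ) • (LinearMap.id : zPoly n →ₗ[ℂ] zPoly n)) := by
    intro q
    obtain ⟨p, hp, h⟩ := exists_Nop_sub_mul_eq hγ hμ q.2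
    refine ⟨⟨p, hp⟩, Subtype.ext (eq_of_mem_zPoly_of_eqOn (Subtype.prop _) q.2 fun z hz => ?_)⟩
    rw [← h z hz, nopLin_eqOn hγ ⟨p, hp⟩ hz]
    rfl
  refine LinearMap.injective_iff_surjective.2 hsurj ?_
  rw [map_zero, LinearMap.sub_apply, LinearMap.smul_apply, LinearMap.id_apply, hp, sub_self]

lemma nopLin_symm {γ : ℝ} (hγ : -1 < γ) {n : ℕ} (p q : zPoly n) :
    (zCore hγ n).inner (nopLin hγ n p) q = (zCore hγ n).inner p (nopLin hγ n q) := by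
  change wip γ (star (nopLin hγ n p : ℂ → ℂ)) q = wip γ (star (p : ℂ → ℂ)) (nopLin hγ n q)
  rw [← wip_congr (fun z hz => rfl) (nopLin_eqOn hγ q), ← wip_Nop_symm hγ]
  · refine wip_congr (fun z hz => ?_) fun z hz => rfl
    rw [Nop_star γ _ hz, Pi.star_apply, nopLin_eqOn hγ p hz]
    rfl
  · exact (continuous_of_mem_zPoly (star_mem_zPoly p.2)).continuousOn
  · exact (continuous_of_mem_zPoly q.2).continuousOn

/-- The normal operator is bounded below on polynomials, with polynomial loss in the degree. -/
lemma exists_norm_le_Nop {γ : ℝ} (hγ : -1 < γ) : ∃ (A : ℝ) (L : ℕ), 0 ≤ A ∧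
    ∀ (j : ℕ) (p : ℂ → ℂ), p ∈ zPoly (j + 1) → ∀ M : ℝ,
      (∀ z ∈ closedBall (0 : ℂ) 1, ‖Nop γ p z‖ ≤ M) →
      ∀ z ∈ closedBall (0 : ℂ) 1, ‖p z‖ ≤ A * ((j : ℝ) + 1) ^ L * M := by
  obtain ⟨C, K, hC, hCK⟩ := exists_nikolskii hγ
  obtain ⟨N, hN⟩ := exists_nat_ge γ
  set W := ∫ z in closedBall (0 : ℂ) 1, dwt γ z with hW
  have hWnn : 0 ≤ W := setIntegral_nonneg measurableSet_closedBall fun z hz => dwt_nonneg γ hz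
  obtain ⟨V, hV⟩ : ∃ V : ℕ, V = 2 * N + 1 := ⟨_, rfl⟩
  refine ⟨√(C * 2 ^ K * W) * (V ^ V / (2 * π)), K + V, by positivity, fun j p hp M hM z hz => ?_⟩
  have hM0 : 0 ≤ M := (norm_nonneg _).trans (hM z hz)
  have hj : (0 : ℝ) ≤ j := j.cast_nonneg
  set m := 2 * π / (V * ((j : ℝ) + 1)) ^ V with hm
  have hVpos : (0 : ℝ) < V := by rw [hV]; positivity
  have hm0 : 0 < m := by positivity
  have hlow : ∀ a b, a + b < j + 1 → m ≤ nopEig γ a b := by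
    intro a b hab
    refine le_trans ?_ (le_nopEig hγ hN a b)
    have h1 : ((a + b : ℕ) : ℝ) ≤ j := by exact_mod_cast Nat.lt_succ_iff.1 hab
    have h2 : (V : ℝ) = 2 * N + 1 := by simp [hV]
    rw [hm, h2, hV]
    gcongr
  have h1 := sq_mul_le_of_symmetric (zCore hγ (j + 1)) (nopLin hγ (j + 1)) (nopLin_symm hγ) hm0
    (fun μ hμ x hx => nopLin_eq_smul hγ (fun a b hab => hμ.trans_le (hlow a b hab)) hx) ⟨p, hp⟩
  change m ^ 2 * (wip γ (star p) p).re ≤ (wip γ (star (nopLin hγ (j + 1) ⟨p, hp⟩ : ℂ → ℂ))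
    (nopLin hγ (j + 1) ⟨p, hp⟩)).re at h1
  rw [wip_star_self, Complex.ofReal_re] at h1
  have h2 := (Complex.re_le_norm _).trans (norm_wip_le hγ (A := M) (B := M)
    (f := star (nopLin hγ (j + 1) ⟨p, hp⟩ : ℂ → ℂ)) (g := nopLin hγ (j + 1) ⟨p, hp⟩)
    (fun z hz => by
      rw [Pi.star_apply, norm_star, ← nopLin_eqOn hγ ⟨p, hp⟩ hz]
      exact hM z hz)
    (fun z hz => by
      rw [← nopLin_eqOn hγ ⟨p, hp⟩ hz]
      exact hM z hz))
  have h3 := hCK (j + 1) p hp z hz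
  set J := ∫ z in closedBall (0 : ℂ) 1, dwt γ z * ‖p z‖ ^ 2
  have hJ : 0 ≤ J := setIntegral_nonneg measurableSet_closedBall fun z hz =>
    mul_nonneg (dwt_nonneg γ hz) (by positivity)
  have h4 : J ≤ W * (M * M) / m ^ 2 := by
    rw [le_div_iff₀ (by positivity), mul_comm]
    exact h1.trans h2
  have h5 : ‖p z‖ ^ 2 ≤ (√(C * 2 ^ K * W) * (V ^ V / (2 * π)) * ((j : ℝ) + 1) ^ (K + V) * M) ^ 2 := by
    calc ‖p z‖ ^ 2 ≤ C * (((j + 1 : ℕ) : ℝ) + 1) ^ K * J := h3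
      _ ≤ C * (2 * ((j : ℝ) + 1)) ^ K * (W * (M * M) / m ^ 2) := by
          gcongr
          push_cast
          linarith
      _ = (C * 2 ^ K * W) * (V ^ V / (2 * π)) ^ 2 * (((j : ℝ) + 1) ^ K * (((j : ℝ) + 1) ^ V) ^ 2) * M ^ 2 := by
          rw [hm, mul_pow, mul_pow]
          field_simp
      _ ≤ (C * 2 ^ K * W) * (V ^ V / (2 * π)) ^ 2 * ((((j : ℝ) + 1) ^ K) ^ 2 *
            (((j : ℝ) + 1) ^ V) ^ 2) * M ^ 2 := by
          gcongr
          exact le_self_pow₀ (one_le_pow₀ (by linarith)) (by norm_num)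
      _ = _ := by
          rw [mul_pow, mul_pow, mul_pow, Real.sq_sqrt (by positivity), pow_add, mul_pow]
  exact le_of_sq_le_sq h5 (by positivity)

lemma exists_Nop_eq {γ : ℝ} (hγ : -1 < γ) {n : ℕ} {q : ℂ → ℂ} (hq : q ∈ zPoly n) :
    ∃ p ∈ zPoly n, EqOn (Nop γ p) q (closedBall 0 1) := by
  obtain ⟨N, hN⟩ := exists_nat_ge γ
  obtain ⟨p, hp, h⟩ := exists_Nop_sub_mul_eq hγ (μ := 0) (n := n)
    (fun a b _ => lt_of_lt_of_le (by positivity) (le_nopEig hγ hN a b)) hq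
  exact ⟨p, hp, fun z hz => by simpa using h z hz⟩

/-- `f` is continuously differentiable on the closed disk with Wirtinger derivatives `a = ∂f/∂z`
and `b = ∂f/∂z̄`. -/
structure HasW (f a b : ℂ → ℂ) : Prop where
  left : ContinuousOn a (closedBall 0 1)
  right : ContinuousOn b (closedBall 0 1)
  deriv : ∀ z ∈ closedBall (0 : ℂ) 1, HasFDerivWithinAt f (wirt (a z) (b z)) (closedBall 0 1) z

namespace HasW

variable {f g a b c e : ℂ → ℂ}

lemma continuousOn (h : HasW f a b) : ContinuousOn f (closedBall 0 1) :=
  fun z hz => (h.deriv z hz).continuousWithinAt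

lemma add (hf : HasW f a b) (hg : HasW g c e) : HasW (f + g) (a + c) (b + e) where
  left := hf.left.add hg.left
  right := hf.right.add hg.right
  deriv z hz := by
    convert! (hf.deriv z hz).add (hg.deriv z hz) using 1
    ext h
    simp
    ring

lemma mul (hf : HasW f a b) (hg : HasW g c e) : HasW (f * g) (a * g + f * c) (b * g + f * e) where
  left := (hf.left.mul hg.continuousOn).add (hf.continuousOn.mul hg.left)
  right := (hf.right.mul hg.continuousOn).add (hf.continuousOn.mul hg.right)
  deriv z hz := by
    convert! (hf.deriv z hz).mul (hg.deriv z hz) using 1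
    ext h
    simp
    ring

lemma const_smul (k : ℂ) (hf : HasW f a b) : HasW (k • f) (k • a) (k • b) where
  left := hf.left.const_smul k
  right := hf.right.const_smul k
  deriv z hz := by
    convert! (hf.deriv z hz).const_smul k using 1
    ext h
    simp
    ring

lemma sub (hf : HasW f a b) (hg : HasW g c e) : HasW (f - g) (a - c) (b - e) where
  left := hf.left.sub hg.left
  right := hf.right.sub hg.right
  deriv z hz := by
    convert! (hf.deriv z hz).sub (hg.deriv z hz) using 1
    ext h
    simp
    ring

lemma star (hf : HasW f a b) : HasW (star f) (star b) (star a) where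
  left := hf.right.star
  right := hf.left.star
  deriv z hz := by
    convert! (Complex.conjCLE : ℂ →L[ℝ] ℂ).hasFDerivAt.comp_hasFDerivWithinAt z (hf.deriv z hz) using 1
    ext h
    simp
    ring

end HasW

lemma hasW_zmono (a b : ℕ) :
    HasW (zmono a b) ((a : ℂ) • zmono (a - 1) b) ((b : ℂ) • zmono a (b - 1)) where
  left := (((contDiff_zmono _ _).continuous).const_smul (a : ℂ)).continuousOn
  right := (((contDiff_zmono _ _).continuous).const_smul (b : ℂ)).continuousOn
  deriv z _ := (hasFDerivAt_zmono a b z).hasFDerivWithinAt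

lemma hasW_id : HasW (fun z => z) 1 0 where
  left := continuousOn_const
  right := continuousOn_const
  deriv z _ := by
    convert! hasFDerivWithinAt_id (𝕜 := ℝ) z (closedBall 0 1) using 1
    ext h
    simp

lemma hasW_conj : HasW (fun z => starRingEnd ℂ z) 0 1 where
  left := continuousOn_const
  right := continuousOn_const
  deriv z _ := by
    convert! (Complex.conjCLE : ℂ →L[ℝ] ℂ).hasFDerivWithinAt using 1
    ext h
    simp

/-- The boundary defining function `1 - |z|²`, complex valued. -/
def cdist (z : ℂ) : ℂ := 1 - z * starRingEnd ℂ z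

lemma hasW_cdist : HasW cdist (fun z => -starRingEnd ℂ z) (fun z => -z) where
  left := by fun_prop
  right := by fun_prop
  deriv z hz := by
    convert! ((hasW_id.mul hasW_conj).deriv z hz).const_sub 1 using 1
    ext h
    simp
    ring

lemma cdist_eq (z : ℂ) : cdist z = ((1 - ‖z‖ ^ 2 : ℝ) : ℂ) := by
  rw [cdist, Complex.mul_conj, Complex.normSq_eq_norm_sq]
  push_cast
  rfl

lemma dwt_two (z : ℂ) : (dwt 2 z : ℂ) = cdist z ^ 2 := by
  rw [cdist_eq, dwt, ← Complex.ofReal_pow]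
  norm_cast

lemma norm_cdist_le {y z : ℂ} (hy : ‖y‖ ≤ 1) (hz : ‖z‖ = 1) : ‖cdist y‖ ≤ 2 * ‖y - z‖ := by
  have h0 := norm_nonneg y
  rw [cdist_eq, Complex.norm_real, Real.norm_eq_abs, abs_of_nonneg (by nlinarith)]
  have h1 : 1 - ‖y‖ ≤ ‖y - z‖ := by
    rw [← hz, norm_sub_rev]
    exact norm_sub_norm_le z y
  nlinarith

lemma integral_eq_zero_of_hasFDerivAt_wirt {G A B : ℂ → ℂ} (hG : Integrable G) (hA : Integrable A)
    (hB : Integrable B) (h : ∀ z, HasFDerivAt G (wirt (A z) (B z)) z) :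
    ∫ z, A z = 0 ∧ ∫ z, B z = 0 := by
  have key : ∀ v : ℂ, (∫ z, A z) * v + (∫ z, B z) * starRingEnd ℂ v = 0 := by
    intro v
    have h1 := integral_bilinear_hasLineDerivAt_right_eq_neg_left_of_integrable
      (μ := (volume : Measure ℂ)) (f := fun _ : ℂ => (1 : ℂ)) (f' := fun _ => 0) (g := G)
      (g' := fun z => A z * v + B z * starRingEnd ℂ v) (v := v) (B := ContinuousLinearMap.mul ℝ ℂ)
      (by simp) (by simpa using! (hA.mul_const v).add (hB.mul_const _)) (by simpa using hG)
      (fun x _ => by simpa using (hasFDerivAt_const (𝕜 := ℝ) (1 : ℂ) x).hasLineDerivAt v)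
      (fun x _ => by simpa using (h x).hasLineDerivAt v)
    simp only [ContinuousLinearMap.mul_apply', one_mul, zero_mul, integral_zero, neg_zero] at h1
    rw [← integral_mul_const, ← integral_mul_const]
    exact (integral_add (hA.mul_const v) (hB.mul_const _)).symm.trans h1
  have k1 := key 1
  have k2 := key Complex.I
  simp only [map_one, mul_one, Complex.conj_I] at k1 k2
  have hI := Complex.I_ne_zero
  have k3 : (∫ z, A z) - (∫ z, B z) = 0 := by
    refine mul_right_cancel₀ hI ?_
    rw [zero_mul]
    linear_combination k2
  constructor
  · linear_combination (k1 + k3) / 2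
  · linear_combination (k1 - k3) / 2

lemma HasW.integral_eq_zero {X a b : ℂ → ℂ} (h : HasW X a b) :
    ∫ z in closedBall (0 : ℂ) 1, (cdist z ^ 2 * a z - 2 * cdist z * starRingEnd ℂ z * X z) = 0 ∧
    ∫ z in closedBall (0 : ℂ) 1, (cdist z ^ 2 * b z - 2 * cdist z * z * X z) = 0 := by
  have hd := hasW_cdist
  have hdc := hd.continuousOn
  have hXc := h.continuousOn
  have hac := h.left
  have hbc := h.right
  have hint : ∀ F : ℂ → ℂ, ContinuousOn F (closedBall 0 1) →
      Integrable ((closedBall (0 : ℂ) 1).indicator F) := fun F hF =>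
    (hF.integrableOn_compact (isCompact_closedBall 0 1)).integrable_indicator
      measurableSet_closedBall
  have hwc : ContinuousOn (fun z : ℂ => starRingEnd ℂ z) (closedBall 0 1) := by fun_prop
  have := integral_eq_zero_of_hasFDerivAt_wirt
    (G := (closedBall (0 : ℂ) 1).indicator fun z => cdist z * cdist z * X z)
    (A := (closedBall (0 : ℂ) 1).indicator fun z =>
      cdist z ^ 2 * a z - 2 * cdist z * starRingEnd ℂ z * X z)
    (B := (closedBall (0 : ℂ) 1).indicator fun z => cdist z ^ 2 * b z - 2 * cdist z * z * X z)
    (hint _ (by fun_prop)) (hint _ (by fun_prop)) (hint _ (by fun_prop)) fun z => ?_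
  · rwa [integral_indicator measurableSet_closedBall, integral_indicator measurableSet_closedBall]
      at this
  rcases lt_trichotomy ‖z‖ 1 with hz | hz | hz
  · have hzm : z ∈ closedBall (0 : ℂ) 1 := mem_closedBall_zero_iff.2 hz.le
    have hnhds : closedBall (0 : ℂ) 1 ∈ nhds z :=
      Filter.mem_of_superset (isOpen_ball.mem_nhds (mem_ball_zero_iff.2 hz)) ball_subset_closedBall
    have h1 := (((hd.mul hd).mul h).deriv z hzm).hasFDerivAt hnhds
    rw [indicator_of_mem hzm, indicator_of_mem hzm]
    have h2 : (closedBall (0 : ℂ) 1).indicator (fun z => cdist z * cdist z * X z) =ᶠ[nhds z]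
        (cdist * cdist * X) := by
      filter_upwards [hnhds] with y hy
      rw [indicator_of_mem hy]
      rfl
    convert! h1.congr_of_eventuallyEq h2 using 2
    · simp only [Pi.add_apply, Pi.mul_apply]
      ring
    · simp only [Pi.add_apply, Pi.mul_apply]
      ring
  · have hzm : z ∈ closedBall (0 : ℂ) 1 := mem_closedBall_zero_iff.2 hz.le
    have hz0 : cdist z = 0 := by simp [cdist_eq, hz]
    rw [indicator_of_mem hzm, indicator_of_mem hzm, hz0]
    have h0 : wirt (0 ^ 2 * a z - 2 * 0 * starRingEnd ℂ z * X z) (0 ^ 2 * b z - 2 * 0 * z * X z) = 0 := by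
      ext h
      simp
    rw [h0]
    obtain ⟨M, hM⟩ := (isCompact_closedBall (0 : ℂ) 1).exists_bound_of_continuousOn hXc
    refine Asymptotics.IsBigO.hasFDerivAt (n := 2) ?_ (by norm_num)
    refine Asymptotics.IsBigO.of_bound (4 * M) (Filter.Eventually.of_forall fun y => ?_)
    have hM0 : 0 ≤ M := (norm_nonneg _).trans (hM z hzm)
    by_cases hy : y ∈ closedBall (0 : ℂ) 1
    · rw [indicator_of_mem hy, norm_mul, norm_mul, norm_pow, norm_norm]
      have h3 := norm_cdist_le (mem_closedBall_zero_iff.1 hy) hz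
      calc ‖cdist y‖ * ‖cdist y‖ * ‖X y‖ ≤ (2 * ‖y - z‖) * (2 * ‖y - z‖) * M := by
            gcongr
            exact hM y hy
        _ = _ := by ring
    · rw [indicator_of_notMem hy, norm_zero]
      positivity
  · have hzm : z ∈ (closedBall (0 : ℂ) 1)ᶜ := by simpa using hz
    have hnhds : (closedBall (0 : ℂ) 1)ᶜ ∈ nhds z := isClosed_closedBall.isOpen_compl.mem_nhds hzm
    rw [indicator_of_notMem hzm, indicator_of_notMem hzm]
    have h0 : wirt 0 0 = 0 := by
      ext h
      simp
    rw [h0]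
    refine (hasFDerivAt_const (0 : ℂ) z).congr_of_eventuallyEq ?_
    filter_upwards [hnhds] with y hy
    rw [indicator_of_notMem hy]

lemma integral_divergence_eq_zero {X Y a b c e : ℂ → ℂ} (hX : HasW X a b) (hY : HasW Y c e) :
    ∫ z in closedBall (0 : ℂ) 1, (cdist z ^ 2 * (a z + e z) -
      2 * cdist z * (starRingEnd ℂ z * X z + z * Y z)) = 0 := by
  have hdc := hasW_cdist.continuousOn
  have hXc := hX.continuousOn
  have hYc := hY.continuousOn
  have hac := hX.left
  have hec := hY.right
  have hwc : ContinuousOn (fun z : ℂ => starRingEnd ℂ z) (closedBall 0 1) := by fun_prop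
  have hint : ∀ F : ℂ → ℂ, ContinuousOn F (closedBall 0 1) →
      IntegrableOn F (closedBall (0 : ℂ) 1) := fun F hF =>
    hF.integrableOn_compact (isCompact_closedBall 0 1)
  have h1 := hX.integral_eq_zero.1
  have h2 := hY.integral_eq_zero.2
  have h3 := integral_add (hint (fun z => cdist z ^ 2 * a z - 2 * cdist z * starRingEnd ℂ z * X z)
    (by fun_prop)) (hint (fun z => cdist z ^ 2 * e z - 2 * cdist z * z * Y z) (by fun_prop))
  rw [h1, h2, add_zero] at h3
  refine Eq.trans (integral_congr_ae (Filter.Eventually.of_forall fun z => ?_)) h3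
  simp only
  ring

/-- `l` is the image of `f` under the operator
`2d(∂∂̄ + ∂̄∂) - 6(z∂ + z̄∂̄) - (z∂ - z̄∂̄)² - 1`, which is symmetric for the weight `d²`. -/
def HasL (f l : ℂ → ℂ) : Prop := ∃ fz fw fzz fzw fwz fww : ℂ → ℂ,
  HasW f fz fw ∧ HasW fz fzz fzw ∧ HasW fw fwz fww ∧ ∀ z ∈ closedBall (0 : ℂ) 1,
    l z = 2 * cdist z * (fzw z + fwz z) - 6 * (z * fz z + starRingEnd ℂ z * fw z) -
      (z * (fz z + z * fzz z - starRingEnd ℂ z * fwz z) -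
        starRingEnd ℂ z * (z * fzw z - fw z - starRingEnd ℂ z * fww z)) - f z

namespace HasL

variable {f g l m : ℂ → ℂ}

lemma continuousOn_left (h : HasL f l) : ContinuousOn f (closedBall 0 1) := by
  obtain ⟨fz, fw, fzz, fzw, fwz, fww, h, -⟩ := h
  exact h.continuousOn

lemma continuousOn_right (h : HasL f l) : ContinuousOn l (closedBall 0 1) := by
  obtain ⟨fz, fw, fzz, fzw, fwz, fww, h, hz, hw, hl⟩ := h
  have h1 := h.continuousOn
  have h2 := hz.continuousOn
  have h3 := hw.continuousOn
  have h4 := hz.left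
  have h5 := hz.right
  have h6 := hw.left
  have h7 := hw.right
  have h8 := hasW_cdist.continuousOn
  have h9 : ContinuousOn (fun z : ℂ => starRingEnd ℂ z) (closedBall 0 1) := by fun_prop
  refine ContinuousOn.congr ?_ hl
  fun_prop

lemma add (hf : HasL f l) (hg : HasL g m) : HasL (f + g) (l + m) := by
  obtain ⟨fz, fw, fzz, fzw, fwz, fww, h, hz, hw, hl⟩ := hf
  obtain ⟨gz, gw, gzz, gzw, gwz, gww, k, kz, kw, km⟩ := hg
  refine ⟨_, _, _, _, _, _, h.add k, hz.add kz, hw.add kw, fun z hz => ?_⟩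
  simp only [Pi.add_apply, hl z hz, km z hz]
  ring

lemma const_smul (c : ℂ) (hf : HasL f l) : HasL (c • f) (c • l) := by
  obtain ⟨fz, fw, fzz, fzw, fwz, fww, h, hz, hw, hl⟩ := hf
  refine ⟨_, _, _, _, _, _, h.const_smul c, hz.const_smul c, hw.const_smul c, fun z hz => ?_⟩
  simp only [Pi.smul_apply, smul_eq_mul, hl z hz]
  ring

lemma wip_eq (hf : HasL f l) (hg : HasL g m) : wip 2 l g = wip 2 f m := by
  have hlc := hf.continuousOn_right
  have hmc := hg.continuousOn_right
  have hfc := hf.continuousOn_left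
  have hgc := hg.continuousOn_left
  obtain ⟨fz, fw, fzz, fzw, fwz, fww, h, hz, hw, hl⟩ := hf
  obtain ⟨gz, gw, gzz, gzw, gwz, gww, k, kz, kw, km⟩ := hg
  have hR := ((hasW_id.mul hz).sub (hasW_conj.mul hw)).mul k |>.sub
    (h.mul ((hasW_id.mul kz).sub (hasW_conj.mul kw)))
  have hX := ((hasW_cdist.mul ((hw.mul k).sub (h.mul kw))).const_smul 2).sub (hasW_id.mul hR)
  have hY := ((hasW_cdist.mul ((hz.mul k).sub (h.mul kz))).const_smul 2).add (hasW_conj.mul hR)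
  have h0 := integral_divergence_eq_zero hX hY
  rw [← sub_eq_zero, wip, wip]
  refine (integral_sub (integrableOn_dwt_mul (by norm_num) (hlc.mul hgc))
    (integrableOn_dwt_mul (by norm_num) (hfc.mul hmc))).symm.trans (Eq.trans ?_ h0)
  refine setIntegral_congr_fun measurableSet_closedBall fun z hz => ?_
  simp only [Pi.add_apply, Pi.mul_apply, Pi.sub_apply, Pi.smul_apply, smul_eq_mul, Pi.one_apply,
    Pi.zero_apply, dwt_two, hl z hz, km z hz]
  ring

lemma zmono (a b : ℕ) : HasL (zmono a b) ((-(((a + b : ℕ) : ℂ) ^ 2 + 6 * ((a + b : ℕ) : ℂ) + 1)) •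
    _root_.zmono a b + (4 * a * b : ℂ) • _root_.zmono (a - 1) (b - 1)) := by
  refine ⟨_, _, _, _, _, _, hasW_zmono a b, (hasW_zmono (a - 1) b).const_smul a,
    (hasW_zmono a (b - 1)).const_smul b, fun z hz => ?_⟩
  simp only [Pi.add_apply, Pi.smul_apply, smul_eq_mul, _root_.zmono, cdist]
  rcases a with _ | _ | a <;> rcases b with _ | _ | b <;> simp <;> ring

end HasL

lemma exists_hasL_of_mem_zPoly {n : ℕ} {p : ℂ → ℂ} (hp : p ∈ zPoly (n + 1)) :
    ∃ r ∈ zPoly n, HasL p ((-((n : ℂ) ^ 2 + 6 * n + 1)) • p + r) := by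
  induction hp using Submodule.span_induction with
  | mem x hx =>
    obtain ⟨a, b, hab, rfl⟩ := hx
    refine ⟨((n : ℂ) ^ 2 + 6 * n - (((a + b : ℕ) : ℂ) ^ 2 + 6 * ((a + b : ℕ) : ℂ))) • zmono a b +
      (4 * a * b : ℂ) • zmono (a - 1) (b - 1), add_mem ?_ ?_, ?_⟩
    · rcases (Nat.lt_succ_iff.1 hab).lt_or_eq with h | h
      · exact Submodule.smul_mem _ _ (zmono_mem_zPoly h)
      · rw [h, sub_self, zero_smul]
        exact zero_mem _
    · rcases Nat.eq_zero_or_pos (a * b) with h | h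
      · have : (4 * a * b : ℂ) = 0 := by
          rw [mul_assoc]
          exact_mod_cast congrArg (4 * ·) h
        rw [this, zero_smul]
        exact zero_mem _
      · have ha := Nat.pos_of_mul_pos_right h
        have hb := Nat.pos_of_mul_pos_left h
        exact Submodule.smul_mem _ _ (zmono_mem_zPoly (by omega))
    · convert! HasL.zmono a b using 1
      ext z
      simp only [Pi.add_apply, Pi.smul_apply, smul_eq_mul]
      ring
  | zero =>
    refine ⟨0, zero_mem _, ?_⟩
    convert! (HasL.zmono 0 0).const_smul 0 using 1 <;> simp
  | add x y hx hy h1 h2 =>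
    obtain ⟨q, hq, hq'⟩ := h1
    obtain ⟨r, hr, hr'⟩ := h2
    refine ⟨q + r, add_mem hq hr, ?_⟩
    convert! hq'.add hr' using 1
    module
  | smul c x hx h =>
    obtain ⟨q, hq, hq'⟩ := h
    refine ⟨c • q, Submodule.smul_mem _ _ hq, ?_⟩
    convert! hq'.const_smul c using 1
    module

lemma CinfDisk.exists_hasW {f : ℂ → ℂ} (hf : CinfDisk f) :
    ∃ a b, CinfDisk a ∧ CinfDisk b ∧ HasW f a b := by
  have hD : ContDiffOn ℝ (⊤ : ℕ∞) (fderivWithin ℝ f (closedBall 0 1)) (closedBall 0 1) :=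
    hf.fderivWithin uniqueDiffOn_closedUnitBall (by simp)
  have h1 : CinfDisk fun z => fderivWithin ℝ f (closedBall 0 1) z 1 :=
    hD.clm_apply contDiffOn_const
  have h2 : CinfDisk fun z => fderivWithin ℝ f (closedBall 0 1) z Complex.I :=
    hD.clm_apply contDiffOn_const
  have h3 : CinfDisk fun z => (2 : ℂ)⁻¹ * (fderivWithin ℝ f (closedBall 0 1) z 1 -
      Complex.I * fderivWithin ℝ f (closedBall 0 1) z Complex.I) :=
    contDiffOn_const.mul (ContDiffOn.sub h1 (contDiffOn_const.mul h2))
  have h4 : CinfDisk fun z => (2 : ℂ)⁻¹ * (fderivWithin ℝ f (closedBall 0 1) z 1 +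
      Complex.I * fderivWithin ℝ f (closedBall 0 1) z Complex.I) :=
    contDiffOn_const.mul (ContDiffOn.add h1 (contDiffOn_const.mul h2))
  refine ⟨_, _, h3, h4, h3.continuousOn, h4.continuousOn, fun z hz => ?_⟩
  convert! ((hf.differentiableOn (by simp)) z hz).hasFDerivWithinAt using 1
  set T := fderivWithin ℝ f (closedBall 0 1) z
  ext h
  have hT : T h = (h.re : ℂ) * T 1 + (h.im : ℂ) * T Complex.I := by
    conv_lhs => rw [← Complex.re_add_im h]
    have : (h.re : ℂ) + h.im * Complex.I = h.re • (1 : ℂ) + h.im • Complex.I := by simp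
    rw [this, map_add, map_smul, map_smul]
    simp
  have hc : starRingEnd ℂ h = h.re - h.im * Complex.I := by
    apply Complex.ext <;> simp
  have hh : h = h.re + h.im * Complex.I := (Complex.re_add_im h).symm
  rw [hT, wirt_apply, hc]
  nth_rewrite 1 [hh]
  linear_combination (-(h.im : ℂ) * T Complex.I) * Complex.I_sq

lemma CinfDisk.exists_hasL {f : ℂ → ℂ} (hf : CinfDisk f) : ∃ l, CinfDisk l ∧ HasL f l := by
  obtain ⟨fz, fw, cz, cw, h⟩ := hf.exists_hasW
  obtain ⟨fzz, fzw, czz, czw, hz⟩ := cz.exists_hasW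
  obtain ⟨fwz, fww, cwz, cww, hw⟩ := cw.exists_hasW
  refine ⟨_, ?_, fz, fw, fzz, fzw, fwz, fww, h, hz, hw, fun z _ => rfl⟩
  have hconj : ContDiff ℝ (⊤ : ℕ∞) (fun z : ℂ => starRingEnd ℂ z) := Complex.conjCLE.contDiff
  have hd : ContDiff ℝ (⊤ : ℕ∞) cdist := contDiff_const.sub (contDiff_id.mul hconj)
  unfold CinfDisk at *
  fun_prop

lemma continuousOn_of_mem_zPoly {n : ℕ} {p : ℂ → ℂ} (hp : p ∈ zPoly n) :
    ContinuousOn p (closedBall 0 1) := (continuous_of_mem_zPoly hp).continuousOn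

lemma wip_add_right {γ : ℝ} (hγ : -1 < γ) {f g₁ g₂ : ℂ → ℂ} (hf : ContinuousOn f (closedBall 0 1))
    (h1 : ContinuousOn g₁ (closedBall 0 1)) (h2 : ContinuousOn g₂ (closedBall 0 1)) :
    wip γ f (g₁ + g₂) = wip γ f g₁ + wip γ f g₂ := by
  rw [wip_comm, wip_add_left hγ h1 h2 hf, wip_comm, wip_comm γ g₂]

lemma wip_smul_right (γ : ℝ) (c : ℂ) (f g : ℂ → ℂ) : wip γ f (c • g) = c * wip γ f g := by
  rw [wip_comm, wip_smul_left, wip_comm]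

lemma wip_sub_left {γ : ℝ} (hγ : -1 < γ) {f₁ f₂ g : ℂ → ℂ} (h1 : ContinuousOn f₁ (closedBall 0 1))
    (h2 : ContinuousOn f₂ (closedBall 0 1)) (hg : ContinuousOn g (closedBall 0 1)) :
    wip γ (f₁ - f₂) g = wip γ f₁ g - wip γ f₂ g := by
  have h := wip_add_left hγ h1 (h2.const_smul (-1 : ℂ)) hg
  rw [wip_smul_left] at h
  rw [sub_eq_add_neg, sub_eq_add_neg, ← neg_one_smul ℂ f₂]
  simpa using! h

/-- Orthogonal projection of a continuous function onto the polynomials of degree less than `n`. -/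
lemma exists_zPoly_proj {γ : ℝ} (hγ : -1 < γ) (n : ℕ) {f : ℂ → ℂ}
    (hf : ContinuousOn f (closedBall 0 1)) : ∃ r ∈ zPoly n, ∀ q ∈ zPoly n, wip γ r q = wip γ f q := by
  let φ : zPoly n →ₗ[ℂ] ℂ :=
    { toFun q := wip γ f q
      map_add' p q := wip_add_right hγ hf (continuousOn_of_mem_zPoly p.2)
        (continuousOn_of_mem_zPoly q.2)
      map_smul' c q := wip_smul_right γ c f q }
  obtain ⟨x, hx⟩ := exists_inner_eq (zCore hγ n) φ
  exact ⟨star x, star_mem_zPoly x.2, fun q hq => hx ⟨q, hq⟩⟩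

lemma eq_zero_of_wip_eq_zero {γ : ℝ} (hγ : -1 < γ) {n : ℕ} {r : ℂ → ℂ} (hr : r ∈ zPoly n)
    (h : ∀ q ∈ zPoly n, wip γ r q = 0) : r = 0 := by
  have h1 := (zCore hγ n).definite ⟨r, hr⟩ ((wip_comm _ _ _).trans (h _ (star_mem_zPoly hr)))
  simpa using congrArg Subtype.val h1

lemma exists_hasL_zPoly {n : ℕ} {q : ℂ → ℂ} (hq : q ∈ zPoly n) : ∃ l ∈ zPoly n, HasL q l := by
  cases n with
  | zero =>
    obtain ⟨r, hr, h⟩ := exists_hasL_of_mem_zPoly (zPoly_mono (Nat.zero_le 1) hq)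
    refine ⟨_, ?_, h⟩
    exact add_mem (Submodule.smul_mem _ _ hq) hr
  | succ n =>
    obtain ⟨r, hr, h⟩ := exists_hasL_of_mem_zPoly hq
    exact ⟨_, add_mem (Submodule.smul_mem _ _ hq) (zPoly_mono (Nat.le_succ n) hr), h⟩

/-- A polynomial of degree at most `n` orthogonal to those of lower degree is an eigenfunction. -/
lemma hasL_of_orthogonal {n : ℕ} {p : ℂ → ℂ} (hp : p ∈ zPoly (n + 1))
    (h : ∀ q ∈ zPoly n, wip 2 p q = 0) : HasL p ((-((n : ℂ) ^ 2 + 6 * n + 1)) • p) := by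
  obtain ⟨r, hr, hpr⟩ := exists_hasL_of_mem_zPoly hp
  have hr0 : r = 0 := by
    refine eq_zero_of_wip_eq_zero (by norm_num : (-1 : ℝ) < 2) hr fun q hq => ?_
    obtain ⟨l, hl, hql⟩ := exists_hasL_zPoly hq
    have h1 := hpr.wip_eq hql
    rw [h l hl, wip_add_left (by norm_num) ((continuousOn_of_mem_zPoly hp).const_smul _)
      (continuousOn_of_mem_zPoly hr) (continuousOn_of_mem_zPoly hq), wip_smul_left, h q hq] at h1
    simpa using h1
  simpa [hr0] using hpr

lemma CinfDisk.exists_wip_pow {f : ℂ → ℂ} (hf : CinfDisk f) (N : ℕ) :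
    ∃ g, CinfDisk g ∧ ∀ (p : ℂ → ℂ) (c : ℂ), HasL p (c • p) → wip 2 p g = c ^ N * wip 2 p f := by
  induction N with
  | zero => exact ⟨f, hf, by simp⟩
  | succ N ih =>
    obtain ⟨g, hg, h⟩ := ih
    obtain ⟨l, hl, hgl⟩ := hg.exists_hasL
    refine ⟨l, hl, fun p c hp => ?_⟩
    rw [← hp.wip_eq hgl, wip_smul_left, h p c hp]
    ring

/-- Rapid decay of the orthogonal components of a smooth function. -/
lemma CinfDisk.exists_decay {f : ℂ → ℂ} (hf : CinfDisk f) (K : ℕ) : ∃ C : ℝ, 0 ≤ C ∧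
    ∀ (m : ℕ) (e : ℂ → ℂ), e ∈ zPoly (m + 1) → (∀ q ∈ zPoly m, wip 2 e q = 0) →
      wip 2 (star e) e = wip 2 (star e) f →
      ∀ z ∈ closedBall (0 : ℂ) 1, ‖e z‖ ≤ C / ((m : ℝ) + 1) ^ K := by
  have h2 : (-1 : ℝ) < 2 := by norm_num
  obtain ⟨C, k, hC, hN⟩ := exists_nikolskii h2
  obtain ⟨g, hg, hgf⟩ := hf.exists_wip_pow (K + k)
  obtain ⟨B, hB⟩ := (isCompact_closedBall (0 : ℂ) 1).exists_bound_of_continuousOn hg.continuousOn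
  have hB0 : 0 ≤ B := (norm_nonneg _).trans (hB 0 (by simp))
  set W := ∫ z in closedBall (0 : ℂ) 1, dwt 2 z with hW
  have hW0 : 0 ≤ W := setIntegral_nonneg measurableSet_closedBall fun z hz => dwt_nonneg 2 hz
  refine ⟨C * 2 ^ k * W * B, by positivity, fun m e he horth hself z hz => ?_⟩
  have hc := continuous_of_mem_zPoly he
  obtain ⟨z0, hz0, hmax⟩ := (isCompact_closedBall (0 : ℂ) 1).exists_isMaxOn ⟨0, by simp⟩
    hc.norm.continuousOn
  have hS : ∀ z ∈ closedBall (0 : ℂ) 1, ‖e z‖ ≤ ‖e z0‖ := fun z hz => hmax hz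
  set S := ‖e z0‖ with hSd
  refine (hS z hz).trans ?_
  set I := ∫ z in closedBall (0 : ℂ) 1, dwt 2 z * ‖e z‖ ^ 2 with hI
  have hI0 : 0 ≤ I := setIntegral_nonneg measurableSet_closedBall fun z hz =>
    mul_nonneg (dwt_nonneg 2 hz) (by positivity)
  have hL := hasL_of_orthogonal (star_mem_zPoly he) fun q hq => by
    have := congrArg (starRingEnd ℂ) (horth _ (star_mem_zPoly hq))
    rwa [wip_star, star_star, map_zero] at this
  have h1 := hgf _ _ hL
  rw [← hself, wip_star_self, ← hI] at h1
  have h3 := norm_wip_le h2 (f := star e) (A := S) (fun z hz => by simpa using hS z hz) hB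
  rw [h1, norm_mul, norm_pow, norm_neg, norm_real, Real.norm_of_nonneg hI0, ← hW] at h3
  have h4 : ‖((m : ℂ) ^ 2 + 6 * m + 1)‖ = (m : ℝ) ^ 2 + 6 * m + 1 := by
    have : ((m : ℂ) ^ 2 + 6 * m + 1) = (((m : ℝ) ^ 2 + 6 * m + 1 : ℝ) : ℂ) := by push_cast; rfl
    rw [this, norm_real, Real.norm_of_nonneg (by positivity)]
  rw [h4] at h3
  have h5 : ((m : ℝ) + 1) ^ (K + k) * I ≤ W * (S * B) := by
    refine le_trans ?_ h3
    gcongr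
    nlinarith [(Nat.cast_nonneg m : (0 : ℝ) ≤ m)]
  have h6 : S ^ 2 ≤ C * (2 ^ k * ((m : ℝ) + 1) ^ k) * I := by
    refine (hN (m + 1) e he z0 hz0).trans ?_
    rw [← mul_pow, ← hI]
    gcongr
    push_cast
    linarith [(Nat.cast_nonneg m : (0 : ℝ) ≤ m)]
  rw [le_div_iff₀ (by positivity)]
  have hS0 : 0 ≤ S := norm_nonneg _
  rcases hS0.eq_or_lt with h0 | h0
  · rw [← h0, zero_mul]
    positivity
  · refine le_of_mul_le_mul_left ?_ h0
    calc S * (S * ((m : ℝ) + 1) ^ K) = S ^ 2 * ((m : ℝ) + 1) ^ K := by ring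
      _ ≤ C * (2 ^ k * ((m : ℝ) + 1) ^ k) * I * ((m : ℝ) + 1) ^ K := by gcongr
      _ = C * 2 ^ k * (((m : ℝ) + 1) ^ (K + k) * I) := by ring
      _ ≤ C * 2 ^ k * (W * (S * B)) := by gcongr
      _ = _ := by ring

/-- Polynomials are uniformly dense in the continuous functions on the disk. -/
lemma exists_zPoly_near {f : ℂ → ℂ} (hf : ContinuousOn f (closedBall 0 1)) {ε : ℝ} (hε : 0 < ε) :
    ∃ n, ∃ p ∈ zPoly n, ∀ z ∈ closedBall (0 : ℂ) 1, ‖f z - p z‖ < ε := by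
  have : CompactSpace (closedBall (0 : ℂ) 1) := isCompact_iff_compactSpace.1 (isCompact_closedBall 0 1)
  let A : StarSubalgebra ℂ C(closedBall (0 : ℂ) 1, ℂ) :=
    { carrier := {φ | ∃ n, ∃ p ∈ zPoly n, ∀ z, φ z = p z}
      mul_mem' := by
        rintro φ ψ ⟨n, p, hp, h⟩ ⟨m, q, hq, k⟩
        exact ⟨_, _, mul_mem_zPoly (zPoly_mono (Nat.le_succ n) hp) (zPoly_mono (Nat.le_succ m) hq),
          fun z => by simp [h, k]⟩
      add_mem' := by
        rintro φ ψ ⟨n, p, hp, h⟩ ⟨m, q, hq, k⟩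
        exact ⟨max n m, _, add_mem (zPoly_mono (le_max_left n m) hp)
          (zPoly_mono (le_max_right n m) hq), fun z => by simp [h, k]⟩
      algebraMap_mem' c := ⟨1, c • zmono 0 0, Submodule.smul_mem _ _ (zmono_mem_zPoly (by simp)),
        fun z => by simp [zmono]⟩
      star_mem' := by
        rintro φ ⟨n, p, hp, h⟩
        exact ⟨n, star p, star_mem_zPoly hp, fun z => by simp [h]⟩ }
  have hA : A.topologicalClosure = ⊤ := by
    rw [eq_top_iff, ← polynomialFunctions.starClosure_topologicalClosure (closedBall (0 : ℂ) 1)]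
    refine StarSubalgebra.topologicalClosure_mono ?_
    rw [polynomialFunctions.starClosure_eq_adjoin_X]
    refine StarAlgebra.adjoin_le ?_
    rintro _ rfl
    exact ⟨2, zmono 1 0, zmono_mem_zPoly (by simp), fun z => by simp [zmono]⟩
  have hmem : (⟨fun z => f z, continuousOn_iff_continuous_domRestrict.1 hf⟩ :
      C(closedBall (0 : ℂ) 1, ℂ)) ∈ A.topologicalClosure := hA ▸ StarSubalgebra.mem_top
  obtain ⟨φ, ⟨n, p, hp, h⟩, hφ⟩ := Metric.mem_closure_iff.1 hmem ε hε
  refine ⟨n, p, hp, fun z hz => ?_⟩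
  rw [ContinuousMap.dist_lt_iff hε] at hφ
  have h1 := hφ ⟨z, hz⟩
  rw [dist_eq_norm, h] at h1
  exact h1

lemma eqOn_zero_of_integral_eq_zero {γ : ℝ} (hγ : -1 < γ) {u : ℂ → ℂ}
    (hu : ContinuousOn u (closedBall 0 1)) (h : wip γ (star u) u = 0) :
    ∀ z ∈ closedBall (0 : ℂ) 1, u z = 0 := by
  rw [wip_star_self, Complex.ofReal_eq_zero] at h
  have hint : IntegrableOn (fun z => dwt γ z * ‖u z‖ ^ 2) (closedBall 0 1) :=
    (integrableOn_dwt hγ).mul_continuousOn (hu.norm.pow 2) (isCompact_closedBall 0 1)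
  have hball : ∀ z ∈ ball (0 : ℂ) 1, u z = 0 := by
    have h0 : ∀ᵐ z ∂volume.restrict (closedBall (0 : ℂ) 1), dwt γ z * ‖u z‖ ^ 2 = 0 :=
      (integral_eq_zero_iff_of_nonneg_ae ((ae_restrict_iff' measurableSet_closedBall).2
        (ae_of_all _ fun z hz => mul_nonneg (dwt_nonneg γ hz) (by positivity))) hint).1 h
    have h1 : ∀ᵐ z ∂volume.restrict (ball (0 : ℂ) 1), u z = 0 := by
      have h2 := ae_restrict_of_ae_restrict_of_subset (ball_subset_closedBall (x := (0 : ℂ))) h0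
      filter_upwards [h2, ae_restrict_mem measurableSet_ball] with z hz hzb
      rw [mem_ball_zero_iff] at hzb
      have hpos : 0 < dwt γ z := Real.rpow_pos_of_pos (by nlinarith [norm_nonneg z]) _
      simpa [hpos.ne'] using hz
    exact MeasureTheory.Measure.eqOn_open_of_ae_eq h1 isOpen_ball
      (hu.mono ball_subset_closedBall) continuousOn_const
  have hcl : EqOn u (fun _ => 0) (closure (ball (0 : ℂ) 1)) := by
    refine EqOn.of_subset_closure (fun z hz => hball z hz) ?_ continuousOn_const
      subset_closure subset_rfl
    rwa [closure_unit_ball]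
  rw [closure_unit_ball] at hcl
  exact hcl

/-- The partial sums of a rapidly decaying sequence converge uniformly, faster than any power. -/
lemma RapidSeq.exists_tail {q : ℕ → ℂ → ℂ} (hq : RapidSeq q) (K : ℕ) : ∃ C : ℝ, 0 ≤ C ∧
    ∀ n : ℕ, ∀ z ∈ closedBall (0 : ℂ) 1,
      ‖(∑' j, q j z) - ∑ j ∈ Finset.range n, q j z‖ ≤ C / ((n : ℝ) + 1) ^ K := by
  obtain ⟨C, hC0, hC⟩ := hq.2 (K + 2)
  have hs := summable_const_div_succ_sq C
  refine ⟨∑' j : ℕ, C / ((j : ℝ) + 1) ^ 2, tsum_nonneg fun j => by positivity, fun n z hz => ?_⟩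
  rw [← (hq.summable hz).sum_add_tsum_nat_add n, add_sub_cancel_left, ← tsum_div_const]
  refine tsum_of_norm_bounded (hs.div_const _).hasSum fun j => (hC _ z hz).trans ?_
  rw [div_div]
  gcongr
  rw [pow_add, mul_comm]
  push_cast
  gcongr <;> linarith [(Nat.cast_nonneg n : (0 : ℝ) ≤ n), (Nat.cast_nonneg j : (0 : ℝ) ≤ j)]

lemma tendsto_const_div_succ_pow (C : ℝ) {K : ℕ} (hK : K ≠ 0) :
    Filter.Tendsto (fun n : ℕ => C / ((n : ℝ) + 1) ^ K) Filter.atTop (nhds 0) := by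
  refine tendsto_const_nhds.div_atTop ((Filter.tendsto_pow_atTop hK).comp ?_)
  exact Filter.tendsto_atTop_add_const_right _ _ tendsto_natCast_atTop_atTop

lemma RapidSeq.sum_mem {q : ℕ → ℂ → ℂ} (hq : RapidSeq q) (n : ℕ) :
    ∑ j ∈ Finset.range n, q j ∈ zPoly n :=
  _root_.sum_mem fun j hj => zPoly_mono (Nat.succ_le_of_lt (Finset.mem_range.1 hj)) (hq.1 j)

/-- Smooth functions have rapidly converging polynomial expansions. -/
theorem CinfDisk.exists_rapidSeq {f : ℂ → ℂ} (hf : CinfDisk f) :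
    ∃ q, RapidSeq q ∧ ∀ z ∈ closedBall (0 : ℂ) 1, f z = ∑' j, q j z := by
  have h2 : (-1 : ℝ) < 2 := by norm_num
  have hfc : ContinuousOn f (closedBall 0 1) := hf.continuousOn
  choose P hP hPf using fun n => exists_zPoly_proj h2 n hfc
  have hmem : ∀ m, P (m + 1) - P m ∈ zPoly (m + 1) := fun m =>
    sub_mem (hP _) (zPoly_mono (Nat.le_succ m) (hP m))
  have horth : ∀ m, ∀ q ∈ zPoly m, wip 2 (P (m + 1) - P m) q = 0 := fun m q hq => by
    rw [wip_sub_left h2 (continuousOn_of_mem_zPoly (hP _)) (continuousOn_of_mem_zPoly (hP _))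
      (continuousOn_of_mem_zPoly hq), hPf _ _ (zPoly_mono (Nat.le_succ m) hq), hPf _ _ hq, sub_self]
  have hself : ∀ m, wip 2 (star (P (m + 1) - P m)) (P (m + 1) - P m) =
      wip 2 (star (P (m + 1) - P m)) f := fun m => by
    have h3 := horth m _ (star_mem_zPoly (hP m))
    have h4 := congrArg (starRingEnd ℂ) h3
    rw [wip_star, star_star, map_zero, wip_comm] at h4
    rw [wip_comm, wip_sub_left h2 (continuousOn_of_mem_zPoly (hP _))
      (continuousOn_of_mem_zPoly (hP _)) (continuousOn_of_mem_zPoly (star_mem_zPoly (hmem m))), h4,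
      sub_zero, hPf _ _ (star_mem_zPoly (hmem m)), wip_comm]
  have hrap : RapidSeq fun m => P (m + 1) - P m := ⟨hmem, fun K => by
    obtain ⟨C, hC0, hC⟩ := hf.exists_decay K
    exact ⟨C, hC0, fun m z hz => hC m _ (hmem m) (horth m) (hself m) z hz⟩⟩
  have hsum : ∀ n, ∑ j ∈ Finset.range n, (P (j + 1) - P j) = P n := fun n => by
    rw [Finset.sum_range_sub, zPoly_zero_eq_zero (hP 0), sub_zero]
  refine ⟨_, hrap, ?_⟩
  set g : ℂ → ℂ := fun z => ∑' j, (P (j + 1) - P j) z with hg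
  have hgc : ContinuousOn g (closedBall 0 1) := hrap.continuousOn_tsum
  have huc : ContinuousOn (f - g) (closedBall 0 1) := hfc.sub hgc
  set W := ∫ z in closedBall (0 : ℂ) 1, dwt 2 z with hW
  have hW0 : 0 ≤ W := setIntegral_nonneg measurableSet_closedBall fun z hz => dwt_nonneg 2 hz
  have hu : ∀ n, ∀ q ∈ zPoly n, wip 2 (f - g) q = 0 := by
    intro n q hq
    obtain ⟨B, hB⟩ := (isCompact_closedBall (0 : ℂ) 1).exists_bound_of_continuousOn
      (continuousOn_of_mem_zPoly hq)
    obtain ⟨C, hC0, hC⟩ := hrap.exists_tail 1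
    have hlim := ((tendsto_const_div_succ_pow C one_ne_zero).mul_const B).const_mul W
    rw [zero_mul, mul_zero] at hlim
    rw [← norm_le_zero_iff]
    refine ge_of_tendsto hlim (Filter.eventually_atTop.2 ⟨n, fun m hm => ?_⟩)
    have h5 : wip 2 (f - g) q = - wip 2 (g - P m) q := by
      rw [wip_sub_left h2 hfc hgc (continuousOn_of_mem_zPoly hq), wip_sub_left h2 hgc
        (continuousOn_of_mem_zPoly (hP m)) (continuousOn_of_mem_zPoly hq),
        hPf m q (zPoly_mono hm hq), neg_sub]
    rw [h5, norm_neg]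
    refine norm_wip_le h2 (fun z hz => ?_) hB
    have := hC m z hz
    rwa [← Finset.sum_apply, hsum] at this
  have hzero : wip 2 (star (f - g)) (f - g) = 0 := by
    obtain ⟨B, hB⟩ := (isCompact_closedBall (0 : ℂ) 1).exists_bound_of_continuousOn huc
    have hB0 : 0 ≤ B := (norm_nonneg _).trans (hB 0 (by simp))
    rw [← norm_le_zero_iff]
    refine le_of_forall_pos_le_add fun ε hε => ?_
    obtain ⟨n, p, hp, hpn⟩ := exists_zPoly_near huc.star (ε := ε / (W * B + 1)) (by positivity)
    have hsc : ContinuousOn (star (f - g)) (closedBall 0 1) := huc.star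
    have h6 : wip 2 (star (f - g)) (f - g) = wip 2 (star (f - g) - p) (f - g) := by
      rw [wip_sub_left h2 hsc (continuousOn_of_mem_zPoly hp) huc, wip_comm 2 p, hu n p hp, sub_zero]
    rw [h6, zero_add]
    refine (norm_wip_le h2 (fun z hz => (hpn z hz).le) hB).trans ?_
    rw [← hW, show W * (ε / (W * B + 1) * B) = (W * B) / (W * B + 1) * ε by ring]
    refine mul_le_of_le_one_left hε.le ?_
    rw [div_le_one (by positivity)]
    linarith
  intro z hz
  exact sub_eq_zero.1 (eqOn_zero_of_integral_eq_zero h2 huc hzero z hz)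

lemma RapidSeq.Nop_eq {γ : ℝ} (hγ : -1 < γ) {q r : ℕ → ℂ → ℂ} (hq : RapidSeq q) (hr : RapidSeq r)
    (h : ∀ j, EqOn (Nop γ (q j)) (r j) (closedBall 0 1)) :
    EqOn (Nop γ fun z => ∑' j, q j z) (fun z => ∑' j, r j z) (closedBall 0 1) := by
  intro z hz
  obtain ⟨C, hC0, hC⟩ := hq.exists_tail 1
  have hpart : ∀ n, Nop γ (∑ j ∈ Finset.range n, q j) z = ∑ j ∈ Finset.range n, r j z := by
    intro n
    induction n with
    | zero => simpa using Nop_smul γ 0 0 hz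
    | succ n ih =>
      rw [Finset.sum_range_succ, Finset.sum_range_succ, Nop_add hγ
        (continuousOn_of_mem_zPoly (hq.sum_mem n)) (continuousOn_of_mem_zPoly (hq.1 n)) hz, ih, h n hz]
  have hdiff : ∀ n, ‖Nop γ (fun z => ∑' j, q j z) z - ∑ j ∈ Finset.range n, r j z‖ ≤
      2 * π * wmass γ * (C / ((n : ℝ) + 1) ^ 1) := by
    intro n
    set g : ℂ → ℂ := fun z => ∑' j, q j z with hg
    set p : ℂ → ℂ := ∑ j ∈ Finset.range n, q j with hp
    have hpc : ContinuousOn p (closedBall 0 1) := continuousOn_of_mem_zPoly (hq.sum_mem n)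
    have hgc : ContinuousOn g (closedBall 0 1) := hq.continuousOn_tsum
    have h1 := Nop_add hγ (hgc.sub hpc) hpc hz
    rw [← hpart n]
    have h3 : g = (g - p) + p := by ring
    have h2 : Nop γ g z - Nop γ p z = Nop γ (g - p) z := by
      conv_lhs => rw [h3]
      exact sub_eq_of_eq_add h1
    rw [h2]
    exact norm_Nop_le hγ (fun w hw => by simpa [hg, hp] using hC n w hw) hz
  have hlim := (tendsto_const_div_succ_pow C one_ne_zero).const_mul (2 * π * wmass γ)
  rw [mul_zero] at hlim
  have h1 := squeeze_zero_norm hdiff hlim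
  have h2 := ((hr.summable hz).hasSum.tendsto_sum_nat).const_sub (Nop γ (fun z => ∑' j, q j z) z)
  exact sub_eq_zero.1 (tendsto_nhds_unique h2 h1)

lemma RapidSeq.exists_Nop {γ : ℝ} (hγ : -1 < γ) {q : ℕ → ℂ → ℂ} (hq : RapidSeq q) :
    ∃ r, RapidSeq r ∧ ∀ j, EqOn (Nop γ (q j)) (r j) (closedBall 0 1) := by
  choose r hr h using fun j => exists_zPoly_Nop hγ (hq.1 j)
  refine ⟨r, rapidSeq_of_le (A := 2 * π * wmass γ) (L := 0) hq hr
    (by have := wmass_nonneg γ; positivity) fun j M hM z hz => ?_, h⟩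
  rw [← h j hz, pow_zero, mul_one]
  exact norm_Nop_le hγ hM hz

lemma Nop_cinfDisk {γ : ℝ} (hγ : -1 < γ) {f : ℂ → ℂ} (hf : CinfDisk f) : CinfDisk (Nop γ f) := by
  obtain ⟨q, hq, hfq⟩ := hf.exists_rapidSeq
  obtain ⟨r, hr, h⟩ := hq.exists_Nop hγ
  refine ContDiffOn.congr hr.cinfDisk fun z hz => ?_
  rw [Nop_congr hfq hz]
  exact hq.Nop_eq hγ hr h hz

lemma eqOn_zero_of_Nop_eq_zero {γ : ℝ} (hγ : -1 < γ) {f : ℂ → ℂ} (hf : CinfDisk f)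
    (h0 : ∀ z ∈ closedBall (0 : ℂ) 1, Nop γ f z = 0) : ∀ z ∈ closedBall (0 : ℂ) 1, f z = 0 := by
  obtain ⟨q, hq, hfq⟩ := hf.exists_rapidSeq
  obtain ⟨A, L, hA, hAL⟩ := exists_norm_le_Nop hγ
  obtain ⟨C, hC0, hC⟩ := hq.exists_tail (L + 1)
  have hfc : ContinuousOn f (closedBall 0 1) := hf.continuousOn
  intro z hz
  set p : ℕ → ℂ → ℂ := fun n => ∑ j ∈ Finset.range n, q j with hp
  have hpc : ∀ n, ContinuousOn (p n) (closedBall 0 1) := fun n =>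
    continuousOn_of_mem_zPoly (hq.sum_mem n)
  have hNp : ∀ n, ∀ w ∈ closedBall (0 : ℂ) 1, ‖Nop γ (p n) w‖ ≤
      2 * π * wmass γ * (C / ((n : ℝ) + 1) ^ (L + 1)) := by
    intro n w hw
    have h1 := Nop_add hγ (hfc.sub (hpc n)) (hpc n) hw
    have h2 : Nop γ (p n) w = - Nop γ (f - p n) w := by
      have h3 : f - p n + p n = f := sub_add_cancel _ _
      have h4 : Nop γ (f - p n + p n) w = 0 := by rw [h3, h0 w hw]
      exact eq_neg_of_add_eq_zero_right (h1.symm.trans h4)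
    rw [h2, norm_neg]
    exact norm_Nop_le hγ (fun y hy => by simpa [hp, hfq y hy] using hC n y hy) hw
  have hpz : ∀ n, ‖p n z‖ ≤ A * (2 * π * wmass γ * C) / ((n : ℝ) + 1) ^ 1 := fun n => by
    refine (hAL n _ (zPoly_mono (Nat.le_succ n) (hq.sum_mem n)) _ (hNp n) z hz).trans_eq ?_
    rw [pow_succ]
    field_simp
  have h1 := squeeze_zero_norm hpz (tendsto_const_div_succ_pow _ one_ne_zero)
  have h2 := (hq.summable hz).hasSum.tendsto_sum_nat
  rw [hfq z hz]
  exact tendsto_nhds_unique h2 (by simpa [hp] using h1)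

lemma exists_cinfDisk_Nop_eq {γ : ℝ} (hγ : -1 < γ) {g : ℂ → ℂ} (hg : CinfDisk g) :
    ∃ f, CinfDisk f ∧ EqOn (Nop γ f) g (closedBall 0 1) := by
  obtain ⟨q, hq, hgq⟩ := hg.exists_rapidSeq
  choose r hr h using fun j => exists_Nop_eq hγ (hq.1 j)
  obtain ⟨A, L, hA, hAL⟩ := exists_norm_le_Nop hγ
  have hrap : RapidSeq r := rapidSeq_of_le hq hr hA fun j M hM =>
    hAL j _ (hr j) M fun z hz => by rw [h j hz]; exact hM z hz
  refine ⟨_, hrap.cinfDisk, fun z hz => ?_⟩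
  rw [hgq z hz]
  exact hrap.Nop_eq hγ hq h hz

/-- For any `γ > -1`, the normal operator `I₀^♯ μ^{-2γ-1} I₀ d^γ` maps
`C^∞(𝔻)` into itself and is a linear bijection of `C^∞(𝔻)` onto itself
(injectivity and surjectivity stated modulo values outside the closed disk, on which the
operator does not depend). -/
theorem normal_operator_isomorphism_Cinfty (γ : ℝ) (hγ : -1 < γ) :
    (∀ f : ℂ → ℂ, CinfDisk f → CinfDisk (Nop γ f)) ∧
    (∀ f₁ f₂ : ℂ → ℂ, CinfDisk f₁ → CinfDisk f₂ →
      Set.EqOn (Nop γ f₁) (Nop γ f₂) (Metric.closedBall 0 1) →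
      Set.EqOn f₁ f₂ (Metric.closedBall 0 1)) ∧
    (∀ g : ℂ → ℂ, CinfDisk g →
      ∃ f : ℂ → ℂ, CinfDisk f ∧ Set.EqOn (Nop γ f) g (Metric.closedBall 0 1)) := by
  refine ⟨fun f hf => Nop_cinfDisk hγ hf, fun f₁ f₂ h1 h2 h z hz => ?_,
    fun g hg => exists_cinfDisk_Nop_eq hγ hg⟩
  refine sub_eq_zero.1 (eqOn_zero_of_Nop_eq_zero hγ (f := f₁ - f₂) (ContDiffOn.sub h1 h2)
    (fun w hw => ?_) z hz)
  have h3 := Nop_add hγ (ContDiffOn.sub h1 h2).continuousOn h2.continuousOn hw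
  have h4 : f₁ - f₂ + f₂ = f₁ := sub_add_cancel _ _
  have h5 : Nop γ (f₁ - f₂ + f₂) w = Nop γ f₂ w := by rw [h4, h hw]
  exact left_eq_add.1 (h5.symm.trans (h3.trans (add_comm _ _)))

end
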